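/- For every β ∈ (0,∞) and h ∈ ℝ, the weak limits ν_{β,h}^{+,±}(·) := lim_{n→∞} lim_{l→∞} ν_{β,h}^+( · | η_i = ±1 for −(n+l) ≤ i ≤ −n ) exist as probability measures on Ω = {−1,+1}^ℤ; ν_{β,h}^{+,+} is a g-measure consistent with P_{β,h}^{+,+} and ν_{β,h}^{+,−} is a g-measure consistent with P_{β,h}^{+,−}; moreover each ν_{β,h}^{+,±} is an extreme point of the convex set of g-measures consistent with the respective g-function. -/

import Mathlib

open MeasureTheory Filter Topology ProbabilityTheory

noncomputable section

/-- Spin value of a Boolean spin: `true ↦ +1`, `false ↦ -1`. -/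
def sval (b : Bool) : ℝ := if b then 1 else -1

/-- Two-dimensional spin configurations. -/
abbrev Cfg2 := ℤ × ℤ → Bool

/-- Two-sided sequences over an alphabet `A`. -/
abbrev ZSeq (A : Type*) := ℤ → A

/-- Pasts: index `k` corresponds to the coordinate `-(k+1)`. -/
abbrev Past (A : Type*) := ℕ → A

/-- The four nearest neighbours of a site of `ℤ²`. -/
def nbrs (x : ℤ × ℤ) : Finset (ℤ × ℤ) :=
  {(x.1 + 1, x.2), (x.1 - 1, x.2), (x.1, x.2 + 1), (x.1, x.2 - 1)}

/-- Boltzmann weight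
`exp(β[Σ_{{x,y}⊆Λ, x∼y} ω_x ω_y + Σ_{x∈Λ, y∉Λ, x∼y} ω_x σ_y] − h Σ_{x∈Λ} ω_x)`
(the sum over unordered pairs inside `Λ` is written as half the ordered sum). -/
def isingWeight (β h : ℝ) (Λ : Finset (ℤ × ℤ)) (σ ω : Cfg2) : ℝ :=
  Real.exp (β * ((∑ x ∈ Λ, ∑ y ∈ Λ.filter (fun y => y ∈ nbrs x),
        sval (ω x) * sval (ω y)) / 2
      + ∑ x ∈ Λ, ∑ y ∈ (nbrs x).filter (fun y => y ∉ Λ), sval (ω x) * sval (σ y))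
    - h * ∑ x ∈ Λ, sval (ω x))

/-- Fill in the values `τ` inside `Λ` and `σ` outside. -/
def fill (Λ : Finset (ℤ × ℤ)) (σ : Cfg2) (τ : ↥Λ → Bool) : Cfg2 :=
  fun x => if hx : x ∈ Λ then τ ⟨x, hx⟩ else σ x

/-- The finite-volume Ising measure in `Λ` with boundary condition `σ`, viewed as a measure on
the full configuration space, the spins outside `Λ` being frozen to `σ`. -/
def isingFV (β h : ℝ) (Λ : Finset (ℤ × ℤ)) (σ : Cfg2) : Measure Cfg2 :=
  (∑ τ : ↥Λ → Bool, ENNReal.ofReal (isingWeight β h Λ σ (fill Λ σ τ)))⁻¹ •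
    ∑ τ : ↥Λ → Bool,
      ENNReal.ofReal (isingWeight β h Λ σ (fill Λ σ τ)) • Measure.dirac (fill Λ σ τ)

/-- The box `[-n,n]²`. -/
def box (n : ℕ) : Finset (ℤ × ℤ) :=
  (Finset.Icc (-(n : ℤ)) (n : ℤ)) ×ˢ (Finset.Icc (-(n : ℤ)) (n : ℤ))

/-- Convergence of a sequence of measures on a product space in the sense of convergence of the
measures of all finite-dimensional cylinder events; for probability measures on `{−1,+1}^ι`
this is exactly weak convergence. -/
def CylTendsto {ι A : Type*} [MeasurableSpace A] (μs : ℕ → Measure (ι → A))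
    (μ : Measure (ι → A)) : Prop :=
  ∀ (s : Finset ι) (f : ι → A),
    Tendsto (fun n => μs n {η | ∀ i ∈ s, η i = f i}) atTop (𝓝 (μ {η | ∀ i ∈ s, η i = f i}))

/-- `μ` is the plus phase `μ_{β,h}^+`: the weak limit of the finite-volume Ising measures on
`[-n,n]²` with all-plus boundary conditions. -/
def IsPlusPhase (β h : ℝ) (μ : Measure Cfg2) : Prop :=
  IsProbabilityMeasure μ ∧ CylTendsto (fun n => isingFV β h (box n) (fun _ => true)) μ

/-- `μ` is the minus phase `μ_{β,h}^-`. -/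
def IsMinusPhase (β h : ℝ) (μ : Measure Cfg2) : Prop :=
  IsProbabilityMeasure μ ∧ CylTendsto (fun n => isingFV β h (box n) (fun _ => false)) μ

/-- The critical inverse temperature `β_c = ln(1+√2)/2`. -/
def betaCrit : ℝ := Real.log (1 + Real.sqrt 2) / 2

/-- Projection of a two-dimensional configuration onto the line `ℤ × {0}`. -/
def lineProj (η : Cfg2) : ZSeq Bool := fun i => η (i, 0)

/-- The Schonmann projection of a measure on `{−1,+1}^{ℤ²}`. -/
def schonmann (μ : Measure Cfg2) : Measure (ZSeq Bool) := μ.map lineProj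

/-- Restriction of a two-sided sequence to its strict past; index `k` is coordinate `-(k+1)`. -/
def restrictPast {A : Type*} (ω : ZSeq A) : Past A := fun k => ω (-(k + 1 : ℤ))

/-- The shift on two-sided sequences. -/
def shiftSeq {A : Type*} : ZSeq A → ZSeq A := fun ω i => ω (i + 1)

/-- The σ-algebra `ℱ_{<0}` generated by the coordinates of negative index. -/
def pastSigma (A : Type*) [MeasurableSpace A] : MeasurableSpace (ZSeq A) :=
  MeasurableSpace.comap (fun ω : ZSeq A => restrictPast ω) inferInstance

/-- The σ-algebra generated by the coordinates in `S`. -/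
def sigmaOn {ι A : Type*} [MeasurableSpace A] (S : Set ι) : MeasurableSpace (ι → A) :=
  MeasurableSpace.comap (fun ω : ι → A => S.restrict ω) inferInstance

/-- A g-function on the alphabet `A`: measurable, `[0,1]`-valued, normalized. -/
def IsGFunction {A : Type*} [Fintype A] [MeasurableSpace A] (P : A → Past A → ℝ) : Prop :=
  (∀ a, Measurable (P a)) ∧ ∀ ω, (∑ a : A, P a ω) = 1 ∧ ∀ a, P a ω ∈ Set.Icc (0 : ℝ) 1

/-- `μ` is a translation-invariant g-measure consistent with the g-function `P`: for each `a`,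
`ω ↦ P a (restrictPast ω)` is a version of the conditional probability `μ(X₀ = a | ℱ_{<0})`. -/
def IsGMeasure {A : Type*} [MeasurableSpace A] (μ : Measure (ZSeq A))
    (P : A → Past A → ℝ) : Prop :=
  IsProbabilityMeasure μ ∧ μ.map shiftSeq = μ ∧
    ∀ a : A, (fun ω => P a (restrictPast ω))
      =ᵐ[μ] μ[Set.indicator {ω : ZSeq A | ω 0 = a} (fun _ => (1 : ℝ)) | pastSigma A]

/-- The `k`-th variation of a g-function: the supremum of `|P a ω − P a σ|` over pasts agreeing
on the coordinates `−k,…,−1`. -/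
def varG {A : Type*} (P : A → Past A → ℝ) (k : ℕ) : ℝ :=
  sSup {d : ℝ | ∃ (a : A) (ω σ' : Past A), (∀ j < k, ω j = σ' j) ∧ d = |P a ω - P a σ'|}

/-- Elementary conditional probability `μ(B | A)`, as a real number. -/
def condProbR {X : Type*} [MeasurableSpace X] (μ : Measure X) (B A : Set X) : ℝ :=
  ((μ[|A]) B).toReal

/-- The event that `η_i = ω` (suitably reindexed) for `−n ≤ i ≤ −1` and `η_i = b`
for `−(n+l) ≤ i ≤ −(n+1)`. -/
def pastEvt (n l : ℕ) (b : Bool) (ω : Past Bool) : Set (ZSeq Bool) :=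
  {η | (∀ i : ℤ, -(n : ℤ) ≤ i → i ≤ -1 → η i = ω (i.natAbs - 1)) ∧
       (∀ i : ℤ, -((n : ℤ) + l) ≤ i → i ≤ -((n : ℤ) + 1) → η i = b)}

/-- The event that `η_i = b` for `−(n+l) ≤ i ≤ −n`. -/
def blockEvt (n l : ℕ) (b : Bool) : Set (ZSeq Bool) :=
  {η | ∀ i : ℤ, -((n : ℤ) + l) ≤ i → i ≤ -(n : ℤ) → η i = b}

/-- The event that `η_i = b` for `−n ≤ i ≤ −1`. -/
def allBlock (n : ℕ) (b : Bool) : Set (ZSeq Bool) :=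
  {η | ∀ i : ℤ, -(n : ℤ) ≤ i → i ≤ -1 → η i = b}

/-- `P` is the g-function `P^{+,b}` obtained from `ν` by conditioning on the symbol `b`
in the far past: `P(a|ω) = lim_n lim_l ν(η₀ = a | η = b on [−(n+l),−(n+1)], η = ω on [−n,−1])`,
both iterated limits being required to exist. -/
def IsCondG (ν : Measure (ZSeq Bool)) (b : Bool) (P : Bool → Past Bool → ℝ) : Prop :=
  ∀ (a : Bool) (ω : Past Bool), ∃ L : ℕ → ℝ,
    (∀ n, Tendsto (fun l => condProbR ν {η | η 0 = a} (pastEvt n l b ω)) atTop (𝓝 (L n))) ∧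
    Tendsto L atTop (𝓝 (P a ω))

/-- `ν'` is the iterated weak limit `lim_n lim_l ν( · | η = b on [−(n+l),−n])`. -/
def IsCondLimitMeasure (ν : Measure (ZSeq Bool)) (b : Bool) (ν' : Measure (ZSeq Bool)) : Prop :=
  ∃ νseq : ℕ → Measure (ZSeq Bool),
    (∀ n, CylTendsto (fun l => ν[|blockEvt n l b]) (νseq n)) ∧ CylTendsto νseq ν'

/-- Stochastic domination: `ν ≤ μ` iff `ν B ≤ μ B` for every increasing measurable event `B`. -/
def StochDom {A : Type*} [MeasurableSpace A] [Preorder A]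
    (ν μ : Measure (ZSeq A)) : Prop :=
  ∀ B : Set (ZSeq A), MeasurableSet B → (∀ ⦃x y : ZSeq A⦄, x ≤ y → x ∈ B → y ∈ B) → ν B ≤ μ B

/-- `π` is the i.i.d. product measure with `π(η_i = +1) = ρ` for each coordinate. -/
def IsBernoulliProd (ρ : ℝ) (π : Measure (ZSeq Bool)) : Prop :=
  IsProbabilityMeasure π ∧ ∀ (s : Finset ℤ) (f : ℤ → Bool),
    π {η | ∀ i ∈ s, η i = f i} = ∏ i ∈ s, ENNReal.ofReal (if f i then ρ else 1 - ρ)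

/-- Splicing of pasts: coordinates `−k,…,−1` (indices `< k`) from `ω`, the rest from `σ`. -/
def splice {A : Type*} (σ ω : Past A) (k : ℕ) : Past A := fun j => if j < k then ω j else σ j

/-- `ν'` is an extreme point of the convex set of g-measures consistent with `P`. -/
def ExtremeGMeasure (ν' : Measure (ZSeq Bool)) (P : Bool → Past Bool → ℝ) : Prop :=
  IsGMeasure ν' P ∧
  ∀ ν₁ ν₂ : Measure (ZSeq Bool), IsGMeasure ν₁ P → IsGMeasure ν₂ P →
    ∀ t : ℝ, t ∈ Set.Ioo (0 : ℝ) 1 →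
      ν' = ENNReal.ofReal t • ν₁ + ENNReal.ofReal (1 - t) • ν₂ → ν₁ = ν' ∧ ν₂ = ν'

/-- The event that the spins on the line are `−1` on `{−m,…,−n} × {0}`. -/
def lineMinusEvt (n m : ℕ) : Set Cfg2 :=
  {η | ∀ i : ℤ, -(m : ℤ) ≤ i → i ≤ -(n : ℤ) → η (i, 0) = false}

/-- Nearest-neighbour adjacency in `ℤ²` (`‖x−y‖₁ = 1`). -/
def adj2 (x y : ℤ × ℤ) : Prop := (x.1 - y.1).natAbs + (x.2 - y.2).natAbs = 1

/-- The event `A_n`: there is an infinite nearest-neighbour path of `+1` spins starting at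
`(n,0)` entirely contained in the half-plane `{x ≤ n}`. -/
def plusPathEvt (n : ℕ) : Set Cfg2 :=
  {η | ∃ γ : ℕ → ℤ × ℤ, γ 0 = ((n : ℤ), 0) ∧ (∀ j, adj2 (γ j) (γ (j + 1))) ∧
    Function.Injective γ ∧ (∀ j, (γ j).1 ≤ (n : ℤ)) ∧ ∀ j, η (γ j) = true}

/-- The block map for the decimation `ν_{l,k}`: the `j`-th letter consists of the spins on
`[j(k+l), j(k+l)+l−1]`. -/
def blockMap (l k : ℕ) (η : ZSeq Bool) : ZSeq (Fin l → Bool) :=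
  fun j r => η (j * ((k : ℤ) + l) + r)

end

/-- Adjacency indicator of `ℤ²`. -/
noncomputable def bond (x y : ℤ × ℤ) : ℝ := if y ∈ nbrs x then 1 else 0

lemma mem_nbrs_comm (x y : ℤ × ℤ) : y ∈ nbrs x ↔ x ∈ nbrs y := by
  simp only [nbrs, Finset.mem_insert, Finset.mem_singleton, Prod.ext_iff]
  omega

lemma bond_comm (x y : ℤ × ℤ) : bond x y = bond y x := by
  simp only [bond, mem_nbrs_comm x y]

lemma bond_nonneg (x y : ℤ × ℤ) : 0 ≤ bond x y := by
  unfold bond; split_ifs <;> norm_num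

lemma sum_bond_le (B : Finset (ℤ × ℤ)) (x : ℤ × ℤ) : ∑ y ∈ B, bond x y ≤ 4 := by
  simp only [bond, Finset.sum_boole]
  have h1 : (B.filter (fun y => y ∈ nbrs x)).card ≤ (nbrs x).card :=
    Finset.card_le_card fun y hy => (Finset.mem_filter.1 hy).2
  have h2 : (nbrs x).card ≤ 4 := Finset.card_le_four
  exact_mod_cast h1.trans h2

/-- The free-boundary Boltzmann weight of the region `B`. -/
noncomputable def gibbs (β h : ℝ) (B : Finset (ℤ × ℤ)) (ω : Cfg2) : ℝ :=
  Real.exp (β * ((∑ x ∈ B, ∑ y ∈ B, bond x y * (sval (ω x) * sval (ω y))) / 2)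
    - h * ∑ x ∈ B, sval (ω x))

lemma gibbs_pos (β h : ℝ) (B : Finset (ℤ × ℤ)) (ω : Cfg2) : 0 < gibbs β h B ω := Real.exp_pos _

lemma sval_mul_add_le (a b c d : Bool) :
    sval a * sval b + sval c * sval d
      ≤ sval (a ⊓ c) * sval (b ⊓ d) + sval (a ⊔ c) * sval (b ⊔ d) := by
  cases a <;> cases b <;> cases c <;> cases d <;> norm_num [sval]

lemma sval_inf_add_sup (a c : Bool) : sval (a ⊓ c) + sval (a ⊔ c) = sval a + sval c := by
  cases a <;> cases c <;> norm_num [sval]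

lemma gibbs_supermodular {β : ℝ} (hβ : 0 ≤ β) (h : ℝ) (B : Finset (ℤ × ℤ)) (ω η : Cfg2) :
    gibbs β h B ω * gibbs β h B η ≤ gibbs β h B (ω ⊓ η) * gibbs β h B (ω ⊔ η) := by
  simp only [gibbs, ← Real.exp_add]
  refine Real.exp_le_exp.2 ?_
  have h1 : (∑ x ∈ B, ∑ y ∈ B, bond x y * (sval (ω x) * sval (ω y)))
      + (∑ x ∈ B, ∑ y ∈ B, bond x y * (sval (η x) * sval (η y)))
      ≤ (∑ x ∈ B, ∑ y ∈ B, bond x y * (sval ((ω ⊓ η) x) * sval ((ω ⊓ η) y)))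
      + (∑ x ∈ B, ∑ y ∈ B, bond x y * (sval ((ω ⊔ η) x) * sval ((ω ⊔ η) y))) := by
    simp only [← Finset.sum_add_distrib, ← mul_add]
    refine Finset.sum_le_sum fun x _ => Finset.sum_le_sum fun y _ => ?_
    exact mul_le_mul_of_nonneg_left (sval_mul_add_le _ _ _ _) (bond_nonneg x y)
  have h2 : (∑ x ∈ B, sval ((ω ⊓ η) x)) + ∑ x ∈ B, sval ((ω ⊔ η) x)
      = (∑ x ∈ B, sval (ω x)) + ∑ x ∈ B, sval (η x) := by
    simp only [← Finset.sum_add_distrib]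
    exact Finset.sum_congr rfl fun x _ => sval_inf_add_sup _ _
  have h3 := mul_le_mul_of_nonneg_left h1 hβ
  have h4 : h * ((∑ x ∈ B, sval ((ω ⊓ η) x)) + ∑ x ∈ B, sval ((ω ⊔ η) x))
      = h * ((∑ x ∈ B, sval (ω x)) + ∑ x ∈ B, sval (η x)) := by rw [h2]
  linarith

lemma sval_mem (a : Bool) : |sval a| = 1 := by cases a <;> norm_num [sval]

lemma gibbs_update_le {β : ℝ} (hβ : 0 ≤ β) (h : ℝ) (B : Finset (ℤ × ℤ)) (ω : Cfg2)
    (z : ℤ × ℤ) (a : Bool) :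
    gibbs β h B ω ≤ Real.exp (8 * β + 2 * |h|) * gibbs β h B (Function.update ω z a) := by
  classical
  simp only [gibbs, ← Real.exp_add]
  refine Real.exp_le_exp.2 ?_
  set η := Function.update ω z a with hη
  have key : ∀ x y, bond x y * (sval (ω x) * sval (ω y)) - bond x y * (sval (η x) * sval (η y))
      ≤ (if x = z then 2 * bond x y else 0) + (if y = z then 2 * bond x y else 0) := by
    intro x y
    have hb := bond_nonneg x y
    have hle : ∀ p q r s : Bool, sval p * sval q - sval r * sval s ≤ 2 := by
      intro p q r s
      cases p <;> cases q <;> cases r <;> cases s <;> norm_num [sval]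
    by_cases hx : x = z
    · have := mul_le_mul_of_nonneg_left (hle (ω x) (ω y) (η x) (η y)) hb
      have h2 : 0 ≤ (if y = z then 2 * bond x y else 0) := by split_ifs <;> linarith
      rw [if_pos hx]; linarith
    · by_cases hy : y = z
      · have := mul_le_mul_of_nonneg_left (hle (ω x) (ω y) (η x) (η y)) hb
        rw [if_neg hx, if_pos hy]; linarith
      · simp [hη, hx, hy]
  have h1 : (∑ x ∈ B, ∑ y ∈ B, bond x y * (sval (ω x) * sval (ω y)))
      - (∑ x ∈ B, ∑ y ∈ B, bond x y * (sval (η x) * sval (η y))) ≤ 16 := by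
    simp only [← Finset.sum_sub_distrib]
    refine (Finset.sum_le_sum fun x _ => Finset.sum_le_sum fun y _ => key x y).trans ?_
    simp only [Finset.sum_add_distrib]
    have e1 : ∑ x ∈ B, ∑ y ∈ B, (if x = z then 2 * bond x y else 0) ≤ 8 := by
      rw [Finset.sum_comm]
      simp only [Finset.sum_ite_eq']
      split_ifs
      · rw [← Finset.mul_sum]; linarith [sum_bond_le B z]
      · simp
    have e2 : ∑ x ∈ B, ∑ y ∈ B, (if y = z then 2 * bond x y else 0) ≤ 8 := by
      simp only [Finset.sum_ite_eq']
      split_ifs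
      · simp only [bond_comm _ z]
        rw [← Finset.mul_sum]; linarith [sum_bond_le B z]
      · simp
    linarith
  have h2 : |(∑ x ∈ B, sval (η x)) - ∑ x ∈ B, sval (ω x)| ≤ 2 := by
    rw [← Finset.sum_sub_distrib]
    refine (Finset.abs_sum_le_sum_abs _ _).trans ?_
    have : ∀ x ∈ B, |sval (η x) - sval (ω x)| ≤ if x = z then 2 else 0 := by
      intro x _
      by_cases hx : x = z
      · rw [if_pos hx]
        exact (abs_sub _ _).trans (by rw [sval_mem, sval_mem]; norm_num)
      · simp [hη, hx]
    refine (Finset.sum_le_sum this).trans ?_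
    rw [Finset.sum_ite_eq']
    split_ifs <;> norm_num
  have h3 := mul_le_mul_of_nonneg_left h1 hβ
  have h4 : h * ((∑ x ∈ B, sval (η x)) - ∑ x ∈ B, sval (ω x)) ≤ |h| * 2 := by
    refine (le_abs_self _).trans ?_
    rw [abs_mul]
    exact mul_le_mul_of_nonneg_left h2 (abs_nonneg h)
  linarith

lemma gibbs_translate (β h : ℝ) (B : Finset (ℤ × ℤ)) (ω : Cfg2) (e : ℤ × ℤ) :
    gibbs β h (B.map (Equiv.addRight e).toEmbedding) (fun x => ω (x - e)) = gibbs β h B ω := by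
  have hb : ∀ x y, bond (x + e) (y + e) = bond x y := by
    intro x y
    have : (y + e ∈ nbrs (x + e)) ↔ y ∈ nbrs x := by
      simp only [nbrs, Finset.mem_insert, Finset.mem_singleton, Prod.ext_iff, Prod.fst_add,
        Prod.snd_add]
      omega
    simp only [bond, this]
  simp [gibbs, Finset.sum_map, hb]

/-- The configurations equal to `+1` outside `Λ`. -/
noncomputable def confs (Λ : Finset (ℤ × ℤ)) : Finset Cfg2 :=
  open Classical in Finset.univ.image (fill Λ (fun _ => true))

lemma mem_confs {Λ : Finset (ℤ × ℤ)} {ω : Cfg2} : ω ∈ confs Λ ↔ ∀ x ∉ Λ, ω x = true := by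
  classical
  simp only [confs, Finset.mem_image, Finset.mem_univ, true_and]
  constructor
  · rintro ⟨τ, rfl⟩ x hx
    simp [fill, hx]
  · intro hω
    refine ⟨fun x => ω x, funext fun x => ?_⟩
    by_cases hx : x ∈ Λ
    · simp [fill, hx]
    · simp [fill, hx, hω x hx]

lemma fill_injective (Λ : Finset (ℤ × ℤ)) (σ : Cfg2) : Function.Injective (fill Λ σ) := by
  intro τ τ' hτ
  funext x
  have := congrFun hτ x
  simpa [fill] using this

lemma sum_confs {M : Type*} [AddCommMonoid M] (Λ : Finset (ℤ × ℤ)) (φ : Cfg2 → M) :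
    ∑ τ : ↥Λ → Bool, φ (fill Λ (fun _ => true) τ) = ∑ ω ∈ confs Λ, φ ω := by
  classical
  rw [confs, Finset.sum_image fun a _ b _ hab => fill_injective _ _ hab]

lemma isingWeight_eq_const_mul_gibbs (β h : ℝ) {Λ B : Finset (ℤ × ℤ)} (hΛ : Λ ⊆ B)
    (hn : ∀ x ∈ Λ, nbrs x ⊆ B) :
    ∃ C : ℝ, 0 < C ∧ ∀ ω ∈ confs Λ,
      isingWeight β h Λ (fun _ => true) ω = C * gibbs β h B ω := by
  classical
  refine ⟨Real.exp (-(β * ((∑ x ∈ B \ Λ, ∑ y ∈ B \ Λ, bond x y) / 2)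
    - h * ∑ x ∈ B \ Λ, (1 : ℝ))), Real.exp_pos _, fun ω hω => ?_⟩
  have hω' : ∀ x ∈ B \ Λ, sval (ω x) = 1 := by
    intro x hx
    rw [mem_confs.1 hω x (Finset.mem_sdiff.1 hx).2]; simp [sval]
  rw [isingWeight, gibbs, ← Real.exp_add]
  congr 1
  set a : ℤ × ℤ → ℤ × ℤ → ℝ := fun x y => bond x y * (sval (ω x) * sval (ω y)) with ha
  have e1 : ∑ x ∈ Λ, ∑ y ∈ Λ.filter (fun y => y ∈ nbrs x), sval (ω x) * sval (ω y)
      = ∑ x ∈ Λ, ∑ y ∈ Λ, a x y := by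
    refine Finset.sum_congr rfl fun x _ => ?_
    rw [Finset.sum_filter]
    refine Finset.sum_congr rfl fun y _ => ?_
    simp only [ha, bond]; split_ifs <;> simp
  have e2 : ∑ x ∈ Λ, ∑ y ∈ (nbrs x).filter (fun y => y ∉ Λ), sval (ω x) * sval true
      = ∑ x ∈ Λ, ∑ y ∈ B \ Λ, a x y := by
    refine Finset.sum_congr rfl fun x hx => ?_
    have : (nbrs x).filter (fun y => y ∉ Λ) = (B \ Λ).filter (fun y => y ∈ nbrs x) := by
      ext y
      simp only [Finset.mem_filter, Finset.mem_sdiff]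
      exact ⟨fun hy => ⟨⟨hn x hx hy.1, hy.2⟩, hy.1⟩, fun hy => ⟨hy.2, hy.1.2⟩⟩
    rw [this, Finset.sum_filter]
    refine Finset.sum_congr rfl fun y hy => ?_
    simp only [ha, bond, hω' y hy]; split_ifs <;> simp [sval]
  have e3 : ∑ x ∈ B \ Λ, ∑ y ∈ Λ, a x y = ∑ x ∈ Λ, ∑ y ∈ B \ Λ, a x y := by
    rw [Finset.sum_comm]
    refine Finset.sum_congr rfl fun x _ => Finset.sum_congr rfl fun y _ => ?_
    simp only [ha, bond_comm y x]; ring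
  have e4 : ∑ x ∈ B \ Λ, ∑ y ∈ B \ Λ, a x y = ∑ x ∈ B \ Λ, ∑ y ∈ B \ Λ, bond x y := by
    refine Finset.sum_congr rfl fun x hx => Finset.sum_congr rfl fun y hy => ?_
    simp [ha, hω' x hx, hω' y hy]
  have e5 : ∑ x ∈ B \ Λ, sval (ω x) = ∑ x ∈ B \ Λ, (1 : ℝ) :=
    Finset.sum_congr rfl hω'
  have e6 : ∑ x ∈ B, ∑ y ∈ B, a x y = ∑ x ∈ Λ, ∑ y ∈ Λ, a x y
      + 2 * ∑ x ∈ Λ, ∑ y ∈ B \ Λ, a x y + ∑ x ∈ B \ Λ, ∑ y ∈ B \ Λ, bond x y := by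
    have hs : ∀ x, ∑ y ∈ B, a x y = ∑ y ∈ B \ Λ, a x y + ∑ y ∈ Λ, a x y :=
      fun x => (Finset.sum_sdiff hΛ).symm
    rw [← Finset.sum_sdiff hΛ]
    simp only [hs, Finset.sum_add_distrib]
    rw [e3, e4]; ring
  have e7 : ∑ x ∈ B, sval (ω x) = ∑ x ∈ B \ Λ, (1 : ℝ) + ∑ x ∈ Λ, sval (ω x) := by
    rw [← Finset.sum_sdiff hΛ, e5]
  rw [e1, e2, e6, e7]
  ring

open Classical in
lemma isingFV_apply (β h : ℝ) (Λ : Finset (ℤ × ℤ)) (A : Set Cfg2) :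
    isingFV β h Λ (fun _ => true) A
      = ENNReal.ofReal ((∑ ω ∈ (confs Λ).filter (· ∈ A), isingWeight β h Λ (fun _ => true) ω)
          / ∑ ω ∈ confs Λ, isingWeight β h Λ (fun _ => true) ω) := by
  have hpos : ∀ ω, 0 < isingWeight β h Λ (fun _ => true) ω := fun ω => Real.exp_pos _
  have hne : (confs Λ).Nonempty := ⟨fun _ => true, mem_confs.2 fun _ _ => rfl⟩
  rw [isingFV, Measure.smul_apply, Measure.finsetSum_apply,
    sum_confs Λ (fun ω => ENNReal.ofReal (isingWeight β h Λ (fun _ => true) ω)),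
    ← ENNReal.ofReal_sum_of_nonneg fun ω _ => (hpos ω).le, smul_eq_mul, mul_comm]
  simp only [Measure.smul_apply, smul_eq_mul]
  rw [sum_confs Λ (fun ω => ENNReal.ofReal (isingWeight β h Λ (fun _ => true) ω)
    * Measure.dirac ω A), ENNReal.ofReal_div_of_pos (Finset.sum_pos (fun ω _ => hpos ω) hne),
    ENNReal.div_eq_inv_mul, mul_comm, ENNReal.ofReal_sum_of_nonneg fun ω _ => (hpos ω).le,
    Finset.sum_filter]
  rw [ENNReal.ofReal_sum_of_nonneg fun ω _ => by split_ifs <;> simp [(hpos ω).le]]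
  congr 1
  refine Finset.sum_congr rfl fun ω _ => ?_
  rw [Measure.dirac_apply]
  by_cases hA : ω ∈ A <;> simp [hA]

open Classical in
/-- The finite-volume probability of `A`, as a ratio of sums of weights of a larger region. -/
lemma isingFV_real (β h : ℝ) {Λ B : Finset (ℤ × ℤ)} (hΛ : Λ ⊆ B) (hn : ∀ x ∈ Λ, nbrs x ⊆ B)
    (A : Set Cfg2) :
    (isingFV β h Λ (fun _ => true)).real A
      = (∑ ω ∈ (confs Λ).filter (· ∈ A), gibbs β h B ω) / ∑ ω ∈ confs Λ, gibbs β h B ω := by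
  obtain ⟨C, hC, hw⟩ := isingWeight_eq_const_mul_gibbs β h hΛ hn
  rw [Measure.real, isingFV_apply, ENNReal.toReal_ofReal]
  · rw [Finset.sum_congr rfl fun ω hω => hw ω (Finset.mem_filter.1 hω).1,
      Finset.sum_congr rfl hw, ← Finset.mul_sum, ← Finset.mul_sum, mul_div_mul_left _ _ hC.ne']
  · exact div_nonneg (Finset.sum_nonneg fun _ _ => (Real.exp_pos _).le)
      (Finset.sum_nonneg fun _ _ => (Real.exp_pos _).le)

/-- The cylinder event that `η` agrees with `f` on `s`. -/
def cyl {ι : Type*} (s : Finset ι) (f : ι → Bool) : Set (ι → Bool) := {η | ∀ i ∈ s, η i = f i}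

lemma mem_cyl {ι : Type*} {s : Finset ι} {f η : ι → Bool} :
    η ∈ cyl s f ↔ ∀ i ∈ s, η i = f i := Iff.rfl

lemma measurableSet_cyl {ι : Type*} (s : Finset ι) (f : ι → Bool) :
    MeasurableSet (cyl s f) := by
  have : cyl s f = ⋂ i ∈ s, (fun η : ι → Bool => η i) ⁻¹' {f i} := by
    ext η; simp [cyl]
  rw [this]
  exact Finset.measurableSet_biInter _ fun i _ => measurable_pi_apply i (MeasurableSet.of_discrete)

lemma CylTendsto.real {ι : Type*} {μs : ℕ → Measure (ι → Bool)} {μ : Measure (ι → Bool)}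
    [IsFiniteMeasure μ] (hμ : CylTendsto μs μ) (s : Finset ι) (f : ι → Bool) :
    Tendsto (fun n => (μs n).real (cyl s f)) atTop (𝓝 (μ.real (cyl s f))) :=
  (ENNReal.tendsto_toReal (measure_ne_top μ _)).comp (hμ s f)

/-- Measures on `{0,1}^ι` are determined by the events that the spins in a finite set are all `b`. -/
lemma ext_of_cyl_const {ι : Type*} [Countable ι] (b : Bool) {μ ν : Measure (ι → Bool)}
    [IsFiniteMeasure μ]
    (hμν : ∀ s : Finset ι, μ (cyl s fun _ => b) = ν (cyl s fun _ => b)) : μ = ν := by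
  classical
  refine ext_of_generate_finite (Set.range fun s : Finset ι => cyl s fun _ => b) ?_ ?_ ?_ ?_
  · apply le_antisymm
    · refine iSup_le fun i => ?_
      rintro _ ⟨t, -, rfl⟩
      have hb : MeasurableSet[MeasurableSpace.generateFrom
          (Set.range fun s : Finset ι => cyl s fun _ => b)] {η : ι → Bool | η i = b} := by
        refine MeasurableSpace.measurableSet_generateFrom ⟨{i}, ?_⟩
        ext η; simp [cyl]
      have hmeas : Measurable[MeasurableSpace.generateFrom
          (Set.range fun s : Finset ι => cyl s fun _ => b)] (fun η : ι → Bool => η i) := by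
        refine @measurable_to_bool _ (MeasurableSpace.generateFrom _) _ ?_
        cases b
        · convert hb.compl using 1
          ext η; simp
        · exact hb
      exact hmeas MeasurableSet.of_discrete
    · refine MeasurableSpace.generateFrom_le ?_
      rintro _ ⟨s, rfl⟩
      exact measurableSet_cyl s _
  · rintro _ ⟨s, rfl⟩ _ ⟨t, rfl⟩ -
    refine ⟨s ∪ t, ?_⟩
    ext η
    simp only [cyl, Finset.mem_union, Set.mem_ofPred_eq, Set.mem_inter_iff]
    exact ⟨fun h => ⟨fun i hi => h i (Or.inl hi), fun i hi => h i (Or.inr hi)⟩,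
      fun h i hi => hi.elim (h.1 i) (h.2 i)⟩
  · rintro _ ⟨s, rfl⟩
    exact hμν s
  · simpa [cyl] using hμν ∅

lemma sum_gibbs_mul_le {β : ℝ} (hβ : 0 ≤ β) (h : ℝ) (B : Finset (ℤ × ℤ))
    {S T U V : Finset Cfg2} (hU : ∀ ω ∈ S, ∀ η ∈ T, ω ⊓ η ∈ U) (hV : ∀ ω ∈ S, ∀ η ∈ T, ω ⊔ η ∈ V) :
    (∑ ω ∈ S, gibbs β h B ω) * ∑ ω ∈ T, gibbs β h B ω
      ≤ (∑ ω ∈ U, gibbs β h B ω) * ∑ ω ∈ V, gibbs β h B ω := by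
  classical
  have h0 : 0 ≤ gibbs β h B := fun ω => (gibbs_pos β h B ω).le
  refine (four_functions_theorem _ _ _ _ h0 h0 h0 h0 (gibbs_supermodular hβ h B) S T).trans ?_
  refine mul_le_mul ?_ ?_ (Finset.sum_nonneg fun _ _ => h0 _) (Finset.sum_nonneg fun _ _ => h0 _)
  · refine Finset.sum_le_sum_of_subset_of_nonneg ?_ fun _ _ _ => h0 _
    intro ω hω
    obtain ⟨a, ha, c, hc, rfl⟩ := Finset.mem_infs.1 hω
    exact hU a ha c hc
  · refine Finset.sum_le_sum_of_subset_of_nonneg ?_ fun _ _ _ => h0 _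
    intro ω hω
    obtain ⟨a, ha, c, hc, rfl⟩ := Finset.mem_sups.1 hω
    exact hV a ha c hc

/-- A finite region together with its nearest neighbours. -/
def thicken (Λ : Finset (ℤ × ℤ)) : Finset (ℤ × ℤ) := Λ ∪ Λ.biUnion nbrs

lemma subset_thicken (Λ : Finset (ℤ × ℤ)) : Λ ⊆ thicken Λ := Finset.subset_union_left

lemma nbrs_subset_thicken {Λ : Finset (ℤ × ℤ)} : ∀ x ∈ Λ, nbrs x ⊆ thicken Λ := fun _ hx =>
  (Finset.subset_biUnion_of_mem nbrs hx).trans Finset.subset_union_right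

lemma sum_confs_pos (β h : ℝ) (B Λ : Finset (ℤ × ℤ)) : 0 < ∑ ω ∈ confs Λ, gibbs β h B ω :=
  Finset.sum_pos (fun ω _ => gibbs_pos β h B ω) ⟨fun _ => true, mem_confs.2 fun _ _ => rfl⟩

lemma isingFV_supermodular {β : ℝ} (hβ : 0 ≤ β) (h : ℝ) (Λ s : Finset (ℤ × ℤ)) (f g : Cfg2) :
    (isingFV β h Λ (fun _ => true)).real (cyl s f)
        * (isingFV β h Λ (fun _ => true)).real (cyl s g)
      ≤ (isingFV β h Λ (fun _ => true)).real (cyl s (f ⊓ g))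
        * (isingFV β h Λ (fun _ => true)).real (cyl s (f ⊔ g)) := by
  classical
  simp only [isingFV_real β h (subset_thicken Λ) nbrs_subset_thicken, div_mul_div_comm]
  refine div_le_div_of_nonneg_right ?_ (mul_self_nonneg _)
  refine sum_gibbs_mul_le hβ h _ ?_ ?_
  · simp only [Finset.mem_filter, mem_confs, mem_cyl]
    rintro ω ⟨h1, h2⟩ η ⟨h3, h4⟩
    exact ⟨fun x hx => by simp [h1 x hx, h3 x hx], fun x hx => by simp [h2 x hx, h4 x hx]⟩
  · simp only [Finset.mem_filter, mem_confs, mem_cyl]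
    rintro ω ⟨h1, h2⟩ η ⟨h3, h4⟩
    exact ⟨fun x hx => by simp [h1 x hx, h3 x hx], fun x hx => by simp [h2 x hx, h4 x hx]⟩

/-- With plus boundary condition, the probability of all-plus events decreases with the volume. -/
lemma isingFV_cyl_antitone {β : ℝ} (hβ : 0 ≤ β) (h : ℝ) {Λ Λ' : Finset (ℤ × ℤ)} (hΛ : Λ ⊆ Λ')
    (s : Finset (ℤ × ℤ)) :
    (isingFV β h Λ' (fun _ => true)).real (cyl s fun _ => true)
      ≤ (isingFV β h Λ (fun _ => true)).real (cyl s fun _ => true) := by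
  classical
  rw [isingFV_real β h (subset_thicken Λ') nbrs_subset_thicken,
    isingFV_real β h (hΛ.trans (subset_thicken Λ')) fun _ hx => nbrs_subset_thicken _ (hΛ hx),
    div_le_div_iff₀ (sum_confs_pos _ _ _ _) (sum_confs_pos _ _ _ _)]
  refine (sum_gibbs_mul_le hβ h _ (U := confs Λ')
    (V := (confs Λ).filter (· ∈ cyl s fun _ => true)) ?_ ?_).trans (le_of_eq (mul_comm _ _))
  · simp only [Finset.mem_filter, mem_confs]
    rintro ω ⟨h1, -⟩ η h2 x hx
    simp [h1 x hx, h2 x fun hx' => hx (hΛ hx')]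
  · simp only [Finset.mem_filter, mem_confs, mem_cyl]
    rintro ω ⟨-, h1⟩ η h2
    exact ⟨fun x hx => by simp [h2 x hx], fun x hx => by simp [h1 x hx]⟩

lemma isingFV_flip {β : ℝ} (hβ : 0 ≤ β) (h : ℝ) {Λ s : Finset (ℤ × ℤ)} (f : Cfg2) {z : ℤ × ℤ}
    (hz : z ∈ Λ) (a : Bool) :
    (isingFV β h Λ (fun _ => true)).real (cyl (insert z s) (Function.update f z !a))
      ≤ Real.exp (8 * β + 2 * |h|)
        * (isingFV β h Λ (fun _ => true)).real (cyl (insert z s) (Function.update f z a)) := by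
  classical
  simp only [isingFV_real β h (subset_thicken Λ) nbrs_subset_thicken]
  rw [← mul_div_assoc, Finset.mul_sum]
  refine div_le_div_of_nonneg_right ?_ (sum_confs_pos _ _ _ _).le
  refine (Finset.sum_le_sum fun ω _ => gibbs_update_le hβ h _ ω z a).trans ?_
  refine le_of_eq ?_
  refine Finset.sum_nbij' (fun ω => Function.update ω z a) (fun ω => Function.update ω z !a)
    ?_ ?_ ?_ ?_ fun _ _ => rfl
  · simp only [Finset.mem_filter, mem_confs, mem_cyl, Finset.mem_insert]
    rintro ω ⟨h1, h2⟩
    refine ⟨fun x hx => ?_, fun x hx => ?_⟩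
    · rw [Function.update_of_ne (by rintro rfl; exact hx hz), h1 x hx]
    · by_cases hxz : x = z
      · subst hxz; simp
      · have := h2 x hx
        simp_all
  · simp only [Finset.mem_filter, mem_confs, mem_cyl, Finset.mem_insert]
    rintro ω ⟨h1, h2⟩
    refine ⟨fun x hx => ?_, fun x hx => ?_⟩
    · rw [Function.update_of_ne (by rintro rfl; exact hx hz), h1 x hx]
    · by_cases hxz : x = z
      · subst hxz; simp
      · have := h2 x hx
        simp_all
  · simp only [Finset.mem_filter, mem_confs, mem_cyl, Finset.mem_insert]
    rintro ω ⟨h1, h2⟩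
    have := h2 z (Or.inl rfl)
    simp_all
  · simp only [Finset.mem_filter, mem_confs, mem_cyl, Finset.mem_insert]
    rintro ω ⟨h1, h2⟩
    have := h2 z (Or.inl rfl)
    simp_all

lemma isingFV_translate (β h : ℝ) (Λ s : Finset (ℤ × ℤ)) (e : ℤ × ℤ) :
    (isingFV β h (Λ.map (Equiv.addRight e).toEmbedding) (fun _ => true)).real
        (cyl (s.map (Equiv.addRight e).toEmbedding) fun _ => true)
      = (isingFV β h Λ (fun _ => true)).real (cyl s fun _ => true) := by
  classical
  have hB : Λ.map (Equiv.addRight e).toEmbedding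
      ⊆ (thicken Λ).map (Equiv.addRight e).toEmbedding :=
    Finset.map_subset_map.2 (subset_thicken Λ)
  have hn : ∀ x ∈ Λ.map (Equiv.addRight e).toEmbedding,
      nbrs x ⊆ (thicken Λ).map (Equiv.addRight e).toEmbedding := by
    intro x hx y hy
    simp only [Finset.mem_map_equiv, Equiv.addRight_symm, Equiv.coe_addRight] at hx ⊢
    refine nbrs_subset_thicken _ hx ?_
    simp only [nbrs, Finset.mem_insert, Finset.mem_singleton, Prod.ext_iff, Prod.fst_add,
      Prod.snd_add, Prod.fst_neg, Prod.snd_neg] at hy ⊢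
    omega
  rw [isingFV_real β h hB hn, isingFV_real β h (subset_thicken Λ) nbrs_subset_thicken]
  congr 1
  · refine Finset.sum_nbij' (fun ω x => ω (x + e)) (fun ω x => ω (x - e)) ?_ ?_ ?_ ?_ ?_
    · simp only [Finset.mem_filter, mem_confs, mem_cyl, Finset.mem_map_equiv, Equiv.addRight_symm,
        Equiv.coe_addRight]
      exact fun ω h1 => ⟨fun x hx => h1.1 _ (by simpa using hx),
        fun x hx => h1.2 _ (by simpa using hx)⟩
    · simp only [Finset.mem_filter, mem_confs, mem_cyl, Finset.mem_map_equiv, Equiv.addRight_symm,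
        Equiv.coe_addRight, ← sub_eq_add_neg]
      exact fun ω h1 => ⟨fun x hx => h1.1 _ hx, fun x hx => h1.2 _ hx⟩
    · simp
    · simp
    · intro ω _
      rw [← gibbs_translate β h (thicken Λ) _ e]
      simp
  · refine Finset.sum_nbij' (fun ω x => ω (x + e)) (fun ω x => ω (x - e)) ?_ ?_ ?_ ?_ ?_
    · simp only [mem_confs, Finset.mem_map_equiv, Equiv.addRight_symm, Equiv.coe_addRight]
      exact fun ω h1 x hx => h1 _ (by simpa using hx)
    · simp only [mem_confs, Finset.mem_map_equiv, Equiv.addRight_symm, Equiv.coe_addRight,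
        ← sub_eq_add_neg]
      exact fun ω h1 x hx => h1 _ hx
    · simp
    · simp
    · intro ω _
      rw [← gibbs_translate β h (thicken Λ) _ e]
      simp

/-- A stationary, fully supported probability measure on `{0,1}^ℤ` whose finite-dimensional
marginals satisfy the FKG lattice condition. -/
structure IsAttractiveStationary (ν : Measure (ZSeq Bool)) : Prop where
  prob : IsProbabilityMeasure ν
  shift : ν.map shiftSeq = ν
  supermodular : ∀ (s : Finset ℤ) (f g : ℤ → Bool),
    ν.real (cyl s f) * ν.real (cyl s g) ≤ ν.real (cyl s (f ⊓ g)) * ν.real (cyl s (f ⊔ g))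
  pos : ∀ (s : Finset ℤ) (f : ℤ → Bool), 0 < ν.real (cyl s f)

namespace IsPlusPhase

variable {β h : ℝ} {μ : Measure Cfg2}

lemma tendsto_real (hμ : IsPlusPhase β h μ) (s : Finset (ℤ × ℤ)) (f : Cfg2) :
    Tendsto (fun n => (isingFV β h (box n) (fun _ => true)).real (cyl s f)) atTop
      (𝓝 (μ.real (cyl s f))) :=
  have := hμ.1
  hμ.2.real s f

lemma supermodular (hβ : 0 ≤ β) (hμ : IsPlusPhase β h μ) (s : Finset (ℤ × ℤ)) (f g : Cfg2) :
    μ.real (cyl s f) * μ.real (cyl s g) ≤ μ.real (cyl s (f ⊓ g)) * μ.real (cyl s (f ⊔ g)) :=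
  le_of_tendsto_of_tendsto' ((hμ.tendsto_real s f).mul (hμ.tendsto_real s g))
    ((hμ.tendsto_real s _).mul (hμ.tendsto_real s _)) fun _ => isingFV_supermodular hβ h _ s f g

lemma eventually_mem_box (z : ℤ × ℤ) : ∀ᶠ n in atTop, z ∈ box n := by
  filter_upwards [eventually_ge_atTop (max z.1.natAbs z.2.natAbs)] with n hn
  simp only [box, Finset.mem_product, Finset.mem_Icc]
  omega

lemma flip (hβ : 0 ≤ β) (hμ : IsPlusPhase β h μ) (s : Finset (ℤ × ℤ)) (f : Cfg2) (z : ℤ × ℤ)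
    (a : Bool) :
    μ.real (cyl (insert z s) (Function.update f z !a))
      ≤ Real.exp (8 * β + 2 * |h|) * μ.real (cyl (insert z s) (Function.update f z a)) :=
  le_of_tendsto_of_tendsto (hμ.tendsto_real _ _) ((hμ.tendsto_real _ _).const_mul _) <| by
    filter_upwards [eventually_mem_box z] with n hn
    exact isingFV_flip hβ h f hn a

lemma cyl_pos (hβ : 0 ≤ β) (hμ : IsPlusPhase β h μ) (s : Finset (ℤ × ℤ)) (f : Cfg2) :
    0 < μ.real (cyl s f) := by
  have := hμ.1
  induction s using Finset.induction_on with
  | empty => simp [cyl]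
  | insert z s _ ih =>
    have h1 : cyl s f ⊆ cyl (insert z s) (Function.update f z !(f z))
        ∪ cyl (insert z s) (Function.update f z (f z)) := by
      intro η hη
      by_cases hz : η z = f z
      · right
        intro x hx
        rcases Finset.mem_insert.1 hx with rfl | hx
        · simpa using hz
        · simpa using hη x hx
      · left
        intro x hx
        by_cases hxz : x = z
        · subst hxz
          rw [Function.update_self]
          cases h1 : η x <;> cases h2 : f x <;> simp_all
        · rw [Function.update_of_ne hxz]
          exact hη x ((Finset.mem_insert.1 hx).resolve_left hxz)
    have h2 := (measureReal_mono h1 (measure_ne_top μ _)).trans (measureReal_union_le _ _)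
    have h3 := hμ.flip hβ s f z (f z)
    rw [Function.update_eq_self] at h2 h3
    by_contra hcon
    have h4 : μ.real (cyl (insert z s) f) = 0 := le_antisymm (not_lt.1 hcon) measureReal_nonneg
    rw [h4, mul_zero] at h3
    linarith

lemma cyl_translate_le (hβ : 0 ≤ β) (hμ : IsPlusPhase β h μ) (s : Finset (ℤ × ℤ)) (e : ℤ × ℤ)
    (he : e.1.natAbs ≤ 1 ∧ e.2.natAbs ≤ 1) :
    μ.real (cyl (s.map (Equiv.addRight e).toEmbedding) fun _ => true)
      ≤ μ.real (cyl s fun _ => true) := by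
  refine le_of_tendsto_of_tendsto' ((hμ.tendsto_real _ _).comp (tendsto_add_atTop_nat 1))
    (hμ.tendsto_real s _) fun n => ?_
  rw [← isingFV_translate β h (box n) s e]
  refine isingFV_cyl_antitone hβ h ?_ _
  intro x hx
  simp only [Finset.mem_map_equiv, Equiv.addRight_symm, Equiv.coe_addRight, box,
    Finset.mem_product, Finset.mem_Icc, Prod.fst_add, Prod.snd_add, Prod.fst_neg,
    Prod.snd_neg] at hx ⊢
  push_cast
  omega

lemma measurable_lineProj : Measurable lineProj :=
  measurable_pi_iff.2 fun i => measurable_pi_apply ((i, 0) : ℤ × ℤ)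

lemma measurable_shiftSeq : Measurable (shiftSeq : ZSeq Bool → ZSeq Bool) :=
  measurable_pi_iff.2 fun i => measurable_pi_apply (i + 1)

/-- The inclusion of the line `ℤ × {0}`. -/
def lineEmb : ℤ ↪ ℤ × ℤ := ⟨fun i => (i, 0), fun i j hij => by simpa using hij⟩

lemma schonmann_apply_cyl (s : Finset ℤ) (f : ℤ → Bool) :
    schonmann μ (cyl s f) = μ (cyl (s.map lineEmb) fun x => f x.1) := by
  rw [schonmann, Measure.map_apply measurable_lineProj (measurableSet_cyl s f)]
  congr 1
  ext η
  simp only [Set.mem_preimage, mem_cyl, Finset.forall_mem_map]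
  rfl

/-- The Schonmann projection of the plus phase is an attractive stationary measure. -/
lemma schonmann_attractive (hβ : 0 ≤ β) (hμ : IsPlusPhase β h μ) :
    IsAttractiveStationary (schonmann μ) := by
  have := hμ.1
  have : IsProbabilityMeasure (schonmann μ) :=
    Measure.isProbabilityMeasure_map measurable_lineProj.aemeasurable
  refine ⟨this, ?_, fun s f g => ?_, fun s f => ?_⟩
  · refine (ext_of_cyl_const true fun s => ?_).symm
    have h1 : shiftSeq ⁻¹' cyl s (fun _ => true)
        = cyl (s.map (Equiv.addRight (1 : ℤ)).toEmbedding) fun _ => true := by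
      ext η
      simp only [Set.mem_preimage, mem_cyl, Finset.forall_mem_map]
      rfl
    have h2 : (s.map (Equiv.addRight (1 : ℤ)).toEmbedding).map lineEmb
        = (s.map lineEmb).map (Equiv.addRight ((1, 0) : ℤ × ℤ)).toEmbedding := by
      rw [Finset.map_map, Finset.map_map]
      congr 1
    rw [Measure.map_apply measurable_shiftSeq (measurableSet_cyl s _), h1, schonmann_apply_cyl,
      schonmann_apply_cyl, h2]
    rw [← measureReal_eq_measureReal_iff]
    refine le_antisymm ?_ (hμ.cyl_translate_le hβ _ _ (by simp))
    have h3 := hμ.cyl_translate_le hβ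
      ((s.map lineEmb).map (Equiv.addRight ((1, 0) : ℤ × ℤ)).toEmbedding) (-1, 0) (by simp)
    have h4 : ((s.map lineEmb).map (Equiv.addRight ((1, 0) : ℤ × ℤ)).toEmbedding).map
        (Equiv.addRight ((-1, 0) : ℤ × ℤ)).toEmbedding = s.map lineEmb := by
      ext x
      simp only [Finset.mem_map_equiv, Equiv.addRight_symm, Equiv.coe_addRight]
      have h5 : x + -(-1, 0) + -(1, 0) = x := by ext <;> simp
      rw [h5]
    rwa [h4] at h3
  · simp only [Measure.real, schonmann_apply_cyl]
    exact hμ.supermodular hβ _ _ _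
  · simp only [Measure.real, schonmann_apply_cyl]
    exact hμ.cyl_pos hβ _ _

end IsPlusPhase

/-- Prepend a symbol to a past. -/
def consPast (a : Bool) (ω : Past Bool) : Past Bool
  | 0 => a
  | j + 1 => ω j

/-- Monotonicity with respect to the order in which the symbol `b` is the larger one. -/
def MonoFor (b : Bool) (F : Past Bool → ℝ) : Prop :=
  ∀ ⦃ω ω' : Past Bool⦄, (∀ j, ω j = b → ω' j = b) → F ω ≤ F ω'

/-- The transfer operator of `P`. -/
noncomputable def transfer (P : Bool → Past Bool → ℝ) :
    (Past Bool → ℝ) →ₗ[ℝ] (Past Bool → ℝ) where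
  toFun F ω := ∑ a, P a ω * F (consPast a ω)
  map_add' F G := by
    funext ω
    simp only [Pi.add_apply, mul_add, Finset.sum_add_distrib]
  map_smul' c F := by
    funext ω
    simp only [Pi.smul_apply, smul_eq_mul, RingHom.id_apply, Finset.mul_sum]
    exact Finset.sum_congr rfl fun a _ => by ring

/-- An attractive g-function that is continuous along pasts spliced with the maximal symbol `b`. -/
structure IsAttractiveG (b : Bool) (P : Bool → Past Bool → ℝ) : Prop where
  nonneg : ∀ a ω, 0 ≤ P a ω
  sum_eq_one : ∀ ω, ∑ a, P a ω = 1
  mono : MonoFor b (P b)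
  tendsto : ∀ ω, Tendsto (fun n => P b (splice (fun _ => b) ω n)) atTop (𝓝 (P b ω))

/-- The indicator of the event that all symbols at positions in `t` are `b`. -/
noncomputable def allEq (b : Bool) (t : Finset ℕ) (ω : Past Bool) : ℝ :=
  open Classical in if ∀ j ∈ t, ω j = b then 1 else 0

lemma allEq_mono (b : Bool) (t : Finset ℕ) : MonoFor b (allEq b t) := by
  intro ω ω' h
  unfold allEq
  split_ifs with h1 h2
  · exact le_rfl
  · exact absurd (fun j hj => h j (h1 j hj)) h2
  · exact zero_le_one
  · exact le_rfl

lemma allEq_nonneg (b : Bool) (t : Finset ℕ) (ω : Past Bool) : 0 ≤ allEq b t ω := by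
  unfold allEq; split_ifs <;> norm_num

lemma allEq_le_one (b : Bool) (t : Finset ℕ) (ω : Past Bool) : allEq b t ω ≤ 1 := by
  unfold allEq; split_ifs <;> norm_num

lemma allEq_dependsOn (b : Bool) (t : Finset ℕ) :
    ∃ m, DependsOn (allEq b t) (Set.Iio m) := by
  refine ⟨t.sup id + 1, fun ω ω' h => ?_⟩
  have : (∀ j ∈ t, ω j = b) ↔ ∀ j ∈ t, ω' j = b :=
    forall₂_congr fun j hj => by
      rw [h j (Set.mem_Iio.2 (Nat.lt_succ_of_le (Finset.le_sup (f := id) hj)))]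
  simp only [allEq, this]

lemma splice_mono {b : Bool} {ω ω' : Past Bool} (h : ∀ j, ω j = b → ω' j = b) (n : ℕ) :
    ∀ j, splice (fun _ => b) ω n j = b → splice (fun _ => b) ω' n j = b := by
  intro j
  unfold splice
  split_ifs
  · exact h j
  · exact id

lemma dependsOn_splice (F : Past Bool → ℝ) (b : Bool) (n : ℕ) :
    DependsOn (fun ω => F (splice (fun _ => b) ω n)) (Set.Iio n) := by
  intro ω ω' h
  show F _ = F _
  congr 1
  funext j
  unfold splice
  split_ifs with hj
  · exact h j hj
  · rfl

lemma DependsOn.continuous_of_Iio {F : Past Bool → ℝ} {m : ℕ} (hF : DependsOn F (Set.Iio m)) :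
    Continuous F := by
  have h1 : F = (fun x : Fin m → Bool => F fun j => if h : j < m then x ⟨j, h⟩ else false)
      ∘ fun (ω : Past Bool) (i : Fin m) => ω i := by
    funext ω
    exact hF fun j hj => by simp [Set.mem_Iio.1 hj]
  rw [h1]
  exact continuous_of_discreteTopology.comp (continuous_pi fun i => continuous_apply _)

lemma DependsOn.mono_Iio {F : Past Bool → ℝ} {m n : ℕ} (hF : DependsOn F (Set.Iio m))
    (hmn : m ≤ n) : DependsOn F (Set.Iio n) :=
  fun _ _ h => hF fun j hj => h j (lt_of_lt_of_le hj hmn)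

lemma transfer_apply (P : Bool → Past Bool → ℝ) (F : Past Bool → ℝ) (ω : Past Bool) :
    transfer P F ω = ∑ a, P a ω * F (consPast a ω) := rfl

lemma transfer_iterate_congr (P : Bool → Past Bool → ℝ) {b : Bool} {F G : Past Bool → ℝ} (n : ℕ) :
    ∀ (i : ℕ), (∀ ω, (∀ j, i + n ≤ j → ω j = b) → F ω = G ω) →
      ∀ ω, (∀ j, i ≤ j → ω j = b) → (transfer P ^ n) F ω = (transfer P ^ n) G ω := by
  induction n with
  | zero => intro i h ω hω; exact h ω hω
  | succ n ih =>
    intro i h ω hω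
    simp only [pow_succ', Module.End.mul_apply, transfer_apply]
    refine Finset.sum_congr rfl fun a _ => ?_
    congr 1
    refine ih (i + 1) (fun ω' h' => h ω' fun j hj => h' j (by omega)) _ fun j hj => ?_
    obtain ⟨j, rfl⟩ : ∃ k, j = k + 1 := ⟨j - 1, by omega⟩
    exact hω j (by omega)

namespace IsAttractiveG

variable {b : Bool} {P : Bool → Past Bool → ℝ}

lemma not_eq (hP : IsAttractiveG b P) (ω : Past Bool) : P (!b) ω = 1 - P b ω := by
  have := hP.sum_eq_one ω
  rw [Fintype.sum_bool] at this
  cases b <;> simp only [Bool.not_true, Bool.not_false] <;> linarith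

lemma le_one (hP : IsAttractiveG b P) (a : Bool) (ω : Past Bool) : P a ω ≤ 1 := by
  rw [← hP.sum_eq_one ω]
  exact Finset.single_le_sum (fun a _ => hP.nonneg a ω) (Finset.mem_univ a)

lemma transfer_eq (hP : IsAttractiveG b P) (F : Past Bool → ℝ) (ω : Past Bool) :
    transfer P F ω = P b ω * F (consPast b ω) + (1 - P b ω) * F (consPast (!b) ω) := by
  rw [transfer_apply, Fintype.sum_bool, ← hP.not_eq]
  cases b
  · simp [add_comm]
  · simp

lemma transfer_mono (hP : IsAttractiveG b P) {F G : Past Bool → ℝ} (hFG : F ≤ G) :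
    transfer P F ≤ transfer P G := by
  intro ω
  rw [transfer_apply, transfer_apply]
  exact Finset.sum_le_sum fun a _ =>
    mul_le_mul_of_nonneg_left (hFG (consPast a ω)) (hP.nonneg a ω)

lemma iterate_mono (hP : IsAttractiveG b P) {F G : Past Bool → ℝ} (hFG : F ≤ G) (n : ℕ) :
    (transfer P ^ n) F ≤ (transfer P ^ n) G := by
  induction n with
  | zero => exact hFG
  | succ n ih =>
    rw [pow_succ']
    exact hP.transfer_mono ih

lemma transfer_monoFor (hP : IsAttractiveG b P) {F : Past Bool → ℝ} (hF : MonoFor b F) :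
    MonoFor b (transfer P F) := by
  intro ω ω' h
  rw [hP.transfer_eq, hP.transfer_eq]
  have h1 : F (consPast b ω) ≤ F (consPast b ω') := hF fun j => by
    cases j with
    | zero => exact id
    | succ j => exact h j
  have h2 : F (consPast (!b) ω) ≤ F (consPast (!b) ω') := hF fun j => by
    cases j with
    | zero => exact id
    | succ j => exact h j
  have h3 : F (consPast (!b) ω') ≤ F (consPast b ω') := hF fun j => by
    cases j with
    | zero => exact fun _ => rfl
    | succ j => exact id
  have h4 := hP.mono h
  have h5 := hP.nonneg b ω
  have h6 := hP.le_one b ω'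
  have h7 := hP.le_one b ω
  nlinarith [mul_nonneg (sub_nonneg.2 h4) (sub_nonneg.2 h3), mul_nonneg h5 (sub_nonneg.2 h1),
    mul_nonneg (sub_nonneg.2 h7) (sub_nonneg.2 h2)]

lemma iterate_monoFor (hP : IsAttractiveG b P) {F : Past Bool → ℝ} (hF : MonoFor b F) (n : ℕ) :
    MonoFor b ((transfer P ^ n) F) := by
  induction n with
  | zero => exact hF
  | succ n ih =>
    rw [pow_succ']
    exact hP.transfer_monoFor ih

lemma transfer_top_le (hP : IsAttractiveG b P) {F : Past Bool → ℝ} (hF : MonoFor b F) :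
    transfer P F (fun _ => b) ≤ F fun _ => b := by
  rw [hP.transfer_eq]
  have h1 : F (consPast b fun _ => b) ≤ F fun _ => b := hF fun _ _ => rfl
  have h2 : F (consPast (!b) fun _ => b) ≤ F fun _ => b := hF fun _ _ => rfl
  have h3 := hP.nonneg b fun _ => b
  have h4 := hP.le_one b fun _ => b
  nlinarith [mul_nonneg h3 (sub_nonneg.2 h1), mul_nonneg (sub_nonneg.2 h4) (sub_nonneg.2 h2)]

lemma iterate_top_antitone (hP : IsAttractiveG b P) {F : Past Bool → ℝ} (hF : MonoFor b F) :
    Antitone fun n => (transfer P ^ n) F fun _ => b := by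
  refine antitone_nat_of_succ_le fun n => ?_
  rw [pow_succ']
  exact hP.transfer_top_le (hP.iterate_monoFor hF n)

lemma iterate_nonneg (hP : IsAttractiveG b P) {F : Past Bool → ℝ} (hF : 0 ≤ F) (n : ℕ) :
    0 ≤ (transfer P ^ n) F := by
  have := hP.iterate_mono hF n
  rwa [map_zero] at this

lemma splice_antitone (hP : IsAttractiveG b P) (ω : Past Bool) (n : ℕ) :
    P b ω ≤ P b (splice (fun _ => b) ω n) :=
  hP.mono fun j hj => by
    unfold splice
    split_ifs
    · exact hj
    · rfl

lemma measurable (hP : IsAttractiveG b P) (a : Bool) : Measurable (P a) := by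
  have hb : Measurable (P b) :=
    measurable_of_tendsto_metrizable
      (fun n => (dependsOn_splice (P b) b n).continuous_of_Iio.measurable)
      (tendsto_pi_nhds.2 hP.tendsto)
  by_cases hab : a = b
  · rwa [hab]
  · have : P a = fun ω => 1 - P b ω := by
      funext ω
      rw [← hP.not_eq, Bool.eq_not_of_ne hab]
    rw [this]
    exact measurable_const.sub hb

lemma measurable_consPast (a : Bool) : Measurable (consPast a) :=
  measurable_pi_iff.2 fun j => by
    cases j with
    | zero => exact measurable_const
    | succ j => exact measurable_pi_apply j

lemma measurable_iterate (hP : IsAttractiveG b P) {F : Past Bool → ℝ} (hF : Measurable F) (n : ℕ) :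
    Measurable ((transfer P ^ n) F) := by
  induction n with
  | zero => exact hF
  | succ n ih =>
    rw [pow_succ', Module.End.mul_apply]
    show Measurable fun ω => ∑ a, P a ω * (transfer P ^ n) F (consPast a ω)
    exact Finset.measurable_fun_sum Finset.univ fun a _ =>
      (hP.measurable a).mul (ih.comp (measurable_consPast a))

lemma abs_iterate_le (hP : IsAttractiveG b P) {F : Past Bool → ℝ} {C : ℝ} (hF : ∀ ω, |F ω| ≤ C)
    (n : ℕ) (ω : Past Bool) : |(transfer P ^ n) F ω| ≤ C := by
  induction n generalizing ω with
  | zero => exact hF ω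
  | succ n ih =>
    rw [pow_succ', Module.End.mul_apply, transfer_apply]
    refine (Finset.abs_sum_le_sum_abs _ _).trans ?_
    calc ∑ a, |P a ω * (transfer P ^ n) F (consPast a ω)| ≤ ∑ a, P a ω * C := by
          refine Finset.sum_le_sum fun a _ => ?_
          rw [abs_mul, abs_of_nonneg (hP.nonneg a ω)]
          exact mul_le_mul_of_nonneg_left (ih _) (hP.nonneg a ω)
      _ = C := by rw [← Finset.sum_mul, hP.sum_eq_one, one_mul]

end IsAttractiveG

lemma isClopen_cyl {ι : Type*} (s : Finset ι) (f : ι → Bool) : IsClopen (cyl s f) := by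
  have : cyl s f = ⋂ i ∈ s, (fun η : ι → Bool => η i) ⁻¹' {f i} := by
    ext η
    simp [mem_cyl]
  rw [this]
  exact s.finite_toSet.isClopen_biInter fun i _ =>
    (isClopen_discrete _).preimage (continuous_apply i)

lemma tendsto_measure_cyl {ι κ : Type*} [Countable ι] {l : Filter κ}
    {μs : κ → ProbabilityMeasure (ι → Bool)} {μ : ProbabilityMeasure (ι → Bool)}
    (h : Tendsto μs l (𝓝 μ)) (s : Finset ι) (f : ι → Bool) :
    Tendsto (fun n => (μs n : Measure (ι → Bool)) (cyl s f)) l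
      (𝓝 ((μ : Measure (ι → Bool)) (cyl s f))) :=
  ProbabilityMeasure.tendsto_measure_of_null_frontier_of_tendsto' h (by
    rw [(isClopen_cyl s f).frontier_eq, measure_empty])

/-- A sequence of probability measures on `{0,1}^ι` converges weakly as soon as the probabilities
that all spins in a finite set equal `b` converge. -/
lemma exists_tendsto_of_cyl_const {ι : Type*} [Countable ι] (b : Bool)
    (μs : ℕ → ProbabilityMeasure (ι → Bool))
    (h : ∀ s : Finset ι, ∃ c : ℝ,
      Tendsto (fun n => (μs n : Measure (ι → Bool)).real (cyl s fun _ => b)) atTop (𝓝 c)) :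
    ∃ μ : ProbabilityMeasure (ι → Bool), Tendsto μs atTop (𝓝 μ) := by
  choose c hc using h
  have key : ∀ x, MapClusterPt x atTop μs → ∀ s, (x : Measure (ι → Bool)).real (cyl s fun _ => b)
      = c s := by
    intro x hx s
    obtain ⟨U, hU, hUx⟩ := mapClusterPt_iff_ultrafilter.1 hx
    have h1 := tendsto_measure_cyl hUx s fun _ => b
    have h2 := (ENNReal.tendsto_toReal (measure_ne_top _ _)).comp h1
    exact tendsto_nhds_unique h2 ((hc s).mono_left hU)
  obtain ⟨μ, -, hμ⟩ := isCompact_univ.exists_mapClusterPt (u := μs) (f := atTop)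
    (by simp)
  refine ⟨μ, ?_⟩
  refine tendsto_nhds_of_unique_mapClusterPt fun x hx => ?_
  have hext : (x : Measure (ι → Bool)) = (μ : Measure (ι → Bool)) := by
    refine ext_of_cyl_const b fun s => ?_
    rw [← ENNReal.toReal_eq_toReal_iff' (measure_ne_top _ _) (measure_ne_top _ _)]
    exact (key x hx s).trans (key μ hμ s).symm
  exact Subtype.ext hext

lemma tendsto_integral_of_continuous {ι κ : Type*} [Countable ι] {l : Filter κ}
    {μs : κ → ProbabilityMeasure (ι → Bool)} {μ : ProbabilityMeasure (ι → Bool)}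
    (h : Tendsto μs l (𝓝 μ)) {F : (ι → Bool) → ℝ} (hF : Continuous F) :
    Tendsto (fun n => ∫ η, F η ∂(μs n : Measure (ι → Bool))) l
      (𝓝 (∫ η, F η ∂(μ : Measure (ι → Bool)))) :=
  ProbabilityMeasure.tendsto_iff_forall_integral_tendsto.1 h
    (BoundedContinuousFunction.mkOfCompact ⟨F, hF⟩)

lemma cyl_congr {ι : Type*} {s : Finset ι} {f g : ι → Bool} (h : ∀ i ∈ s, f i = g i) :
    cyl s f = cyl s g := by
  ext η
  exact forall₂_congr fun i hi => by rw [h i hi]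

lemma blockEvt_eq_cyl (n l : ℕ) (b : Bool) :
    blockEvt n l b = cyl (Finset.Icc (-((n : ℤ) + l)) (-(n : ℤ))) fun _ => b := by
  ext η
  simp [blockEvt, cyl]

lemma pastEvt_eq_cyl (n l : ℕ) (b : Bool) (ω : Past Bool) :
    pastEvt n l b ω = cyl (Finset.Icc (-((n : ℤ) + l)) (-1))
      fun i => splice (fun _ => b) ω n (i.natAbs - 1) := by
  ext η
  simp only [pastEvt, cyl, splice, Set.mem_ofPred_eq, Finset.mem_Icc, and_imp]
  refine ⟨fun h i hi hi' => ?_, fun h => ⟨fun i hi hi' => ?_, fun i hi hi' => ?_⟩⟩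
  · split_ifs with hn
    · exact h.1 i (by omega) hi'
    · exact h.2 i hi (by omega)
  · rw [h i (by omega) hi', if_pos (by omega)]
  · rw [h i hi (by omega), if_neg (by omega)]

lemma pastEvt_splice {m n : ℕ} (hnm : n ≤ m) (l : ℕ) (b : Bool) (ω : Past Bool) :
    pastEvt m l b (splice (fun _ => b) ω n) = pastEvt n (l + (m - n)) b ω := by
  rw [pastEvt_eq_cyl, pastEvt_eq_cyl]
  have : -((m : ℤ) + l) = -((n : ℤ) + (l + (m - n) : ℕ)) := by omega
  rw [this]
  refine cyl_congr fun i _ => ?_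
  unfold splice
  split_ifs <;> first | rfl | omega

lemma measurableSet_pastEvt (n l : ℕ) (b : Bool) (ω : Past Bool) :
    MeasurableSet (pastEvt n l b ω) := by
  rw [pastEvt_eq_cyl]
  exact measurableSet_cyl _ _

lemma measurableSet_blockEvt (n l : ℕ) (b : Bool) : MeasurableSet (blockEvt n l b) := by
  rw [blockEvt_eq_cyl]
  exact measurableSet_cyl _ _

lemma measurableSet_coord {ι : Type*} (i : ι) (a : Bool) :
    MeasurableSet {η : ι → Bool | η i = a} :=
  (measurable_pi_apply i : Measurable fun η : ι → Bool => η i) (measurableSet_singleton a)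

lemma cyl_inter_coord {s : Finset ℤ} (hs : (0 : ℤ) ∉ s) (f : ℤ → Bool) (a : Bool) :
    cyl s f ∩ {η | η 0 = a} = cyl (insert 0 s) (Function.update f 0 a) := by
  ext η
  simp only [cyl, Set.mem_inter_iff, Set.mem_ofPred_eq, Finset.forall_mem_insert,
    Function.update_self]
  rw [and_comm]
  refine and_congr_right fun _ => forall₂_congr fun i hi => ?_
  rw [Function.update_of_ne (ne_of_mem_of_not_mem hi hs)]

namespace IsAttractiveStationary

variable {ν : Measure (ZSeq Bool)} {b : Bool} {P : Bool → Past Bool → ℝ}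

lemma condProbR_eq {A : Set (ZSeq Bool)} (hA : MeasurableSet A) (B : Set (ZSeq Bool)) :
    condProbR ν B A = ν.real (A ∩ B) / ν.real A := by
  rw [condProbR, cond_apply hA, ENNReal.toReal_mul, ENNReal.toReal_inv, div_eq_inv_mul]
  rfl

lemma real_cyl_split (hν : IsAttractiveStationary ν) (s : Finset ℤ) (f : ℤ → Bool) :
    ν.real (cyl s f) =
      ν.real (cyl s f ∩ {η | η 0 = b}) + ν.real (cyl s f ∩ {η | η 0 = !b}) := by
  have := hν.prob
  rw [← measureReal_inter_add_sdiff (s := cyl s f) (measurableSet_coord 0 b)]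
  congr 2
  ext η
  simp [Bool.eq_not]

lemma real_cyl_coord_mul_le (hν : IsAttractiveStationary ν) {s : Finset ℤ} (hs : (0 : ℤ) ∉ s)
    {f g : ℤ → Bool} (hfg : ∀ i ∈ s, f i = b → g i = b) :
    ν.real (cyl s f ∩ {η | η 0 = b}) * ν.real (cyl s g ∩ {η | η 0 = !b}) ≤
      ν.real (cyl s g ∩ {η | η 0 = b}) * ν.real (cyl s f ∩ {η | η 0 = !b}) := by
  simp only [cyl_inter_coord hs]
  refine (hν.supermodular _ _ _).trans ?_
  cases b
  · refine le_of_eq ?_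
    congr 2 <;> refine cyl_congr fun i hi => ?_
    all_goals
      by_cases h0 : i = 0
      · subst h0; simp
      · have := hfg i ((Finset.mem_insert.1 hi).resolve_left h0)
        simp only [Pi.inf_apply, Pi.sup_apply, ne_eq, h0, not_false_eq_true,
          Function.update_of_ne]
        revert this
        cases f i <;> cases g i <;> simp
  · rw [mul_comm]
    refine le_of_eq ?_
    congr 2 <;> refine cyl_congr fun i hi => ?_
    all_goals
      by_cases h0 : i = 0
      · subst h0; simp
      · have := hfg i ((Finset.mem_insert.1 hi).resolve_left h0)
        simp only [Pi.inf_apply, Pi.sup_apply, ne_eq, h0, not_false_eq_true,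
          Function.update_of_ne]
        revert this
        cases f i <;> cases g i <;> simp

lemma condProbR_mono (hν : IsAttractiveStationary ν) {s : Finset ℤ} (hs : (0 : ℤ) ∉ s)
    {f g : ℤ → Bool} (hfg : ∀ i ∈ s, f i = b → g i = b) :
    condProbR ν {η | η 0 = b} (cyl s f) ≤ condProbR ν {η | η 0 = b} (cyl s g) := by
  rw [condProbR_eq (measurableSet_cyl s f), condProbR_eq (measurableSet_cyl s g),
    div_le_div_iff₀ (hν.pos s f) (hν.pos s g), hν.real_cyl_split (b := b) s f,
    hν.real_cyl_split (b := b) s g, mul_add, mul_add]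
  have := hν.real_cyl_coord_mul_le hs hfg
  linarith [mul_comm (ν.real (cyl s f ∩ {η | η 0 = b})) (ν.real (cyl s g ∩ {η | η 0 = b}))]

lemma pastEvt_pos (hν : IsAttractiveStationary ν) (n l : ℕ) (b : Bool) (ω : Past Bool) :
    0 < ν.real (pastEvt n l b ω) := by
  rw [pastEvt_eq_cyl]
  exact hν.pos _ _

lemma blockEvt_pos (hν : IsAttractiveStationary ν) (n l : ℕ) (b : Bool) :
    0 < ν.real (blockEvt n l b) := by
  rw [blockEvt_eq_cyl]
  exact hν.pos _ _

end IsAttractiveStationary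

namespace IsCondG

variable {ν : Measure (ZSeq Bool)} {b : Bool} {P : Bool → Past Bool → ℝ}

lemma tendsto_condProbR (hG : IsCondG ν b P) (a : Bool) (ω : Past Bool) (n : ℕ) :
    Tendsto (fun l => condProbR ν {η | η 0 = a} (pastEvt n l b ω)) atTop
        (𝓝 (P a (splice (fun _ => b) ω n))) ∧
      Tendsto (fun n => P a (splice (fun _ => b) ω n)) atTop (𝓝 (P a ω)) := by
  obtain ⟨L, hL, hLP⟩ := hG a ω
  have key : ∀ n, P a (splice (fun _ => b) ω n) = L n := by
    intro n
    obtain ⟨L', hL', hLP'⟩ := hG a (splice (fun _ => b) ω n)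
    refine tendsto_nhds_unique hLP' ((tendsto_congr' ?_).2 tendsto_const_nhds)
    filter_upwards [eventually_ge_atTop n] with m hm
    refine tendsto_nhds_unique (hL' m) ?_
    simp only [pastEvt_splice hm]
    exact (tendsto_add_atTop_iff_nat (m - n)).2 (hL n)
  simp only [key]
  exact ⟨hL n, hLP⟩

lemma isAttractiveG (hG : IsCondG ν b P) (hν : IsAttractiveStationary ν) :
    IsAttractiveG b P where
  nonneg a ω := by
    refine ge_of_tendsto' (hG.tendsto_condProbR a ω 0).2 fun n => ?_
    exact ge_of_tendsto' (hG.tendsto_condProbR a ω n).1 fun l => ENNReal.toReal_nonneg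
  sum_eq_one ω := by
    have h1 := (tendsto_finsetSum Finset.univ
      fun a _ => (hG.tendsto_condProbR a ω 0).2)
    refine tendsto_nhds_unique h1 ((tendsto_congr fun n => ?_).2 tendsto_const_nhds)
    have h2 := (tendsto_finsetSum Finset.univ
      fun a _ => (hG.tendsto_condProbR a ω n).1)
    refine tendsto_nhds_unique h2 ((tendsto_congr fun l => ?_).2 tendsto_const_nhds)
    have h3 := hν.pastEvt_pos n l b ω
    simp only [IsAttractiveStationary.condProbR_eq (measurableSet_pastEvt n l b ω),
      Fintype.sum_bool, ← add_div]
    rw [div_eq_one_iff_eq h3.ne', pastEvt_eq_cyl]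
    exact (hν.real_cyl_split (b := true) _ _).symm
  mono := by
    intro ω ω' h
    refine le_of_tendsto_of_tendsto' (hG.tendsto_condProbR b ω 0).2
      (hG.tendsto_condProbR b ω' 0).2 fun n => ?_
    refine le_of_tendsto_of_tendsto' (hG.tendsto_condProbR b ω n).1
      (hG.tendsto_condProbR b ω' n).1 fun l => ?_
    rw [pastEvt_eq_cyl, pastEvt_eq_cyl]
    exact hν.condProbR_mono (by simp) fun i _ => splice_mono h n _
  tendsto ω := (hG.tendsto_condProbR b ω 0).2

end IsCondG

/-- The indicator of the event of agreeing with `ω₀` at the positions before `n`. -/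
noncomputable def agree (n : ℕ) (ω₀ : Past Bool) (ω : Past Bool) : ℝ :=
  open Classical in if ∀ j < n, ω j = ω₀ j then 1 else 0

lemma restrictPast_shiftSeq (η : ZSeq Bool) :
    restrictPast (shiftSeq η) = consPast (η 0) (restrictPast η) := by
  funext j
  cases j with
  | zero => simp [restrictPast, shiftSeq, consPast]
  | succ j =>
    simp only [restrictPast, shiftSeq, consPast]
    congr 1

lemma iterate_shiftSeq (η : ZSeq Bool) (k : ℕ) (i : ℤ) : shiftSeq^[k] η i = η (i + k) := by
  induction k generalizing η with
  | zero => simp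
  | succ k ih =>
    rw [Function.iterate_succ_apply, ih]
    simp [shiftSeq, add_assoc]

lemma continuous_shiftSeq : Continuous (shiftSeq : ZSeq Bool → ZSeq Bool) :=
  continuous_pi fun i => continuous_apply (i + 1)

lemma continuous_restrictPast : Continuous (restrictPast : ZSeq Bool → Past Bool) :=
  continuous_pi fun k => continuous_apply (-(k + 1 : ℤ))

lemma preimage_shiftSeq_blockEvt (n l : ℕ) (b : Bool) :
    shiftSeq ⁻¹' blockEvt (n + 1) l b = blockEvt n l b := by
  ext η
  simp only [blockEvt, shiftSeq, Set.mem_preimage, Set.mem_ofPred_eq]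
  refine ⟨fun h i hi hi' => ?_, fun h i hi hi' => h _ (by omega) (by omega)⟩
  have := h (i - 1) (by omega) (by omega)
  rwa [sub_add_cancel] at this

lemma preimage_shiftSeq_pastEvt (n l : ℕ) (b : Bool) (ω : Past Bool) :
    shiftSeq ⁻¹' pastEvt (n + 1) l b ω =
      pastEvt n l b (fun j => ω (j + 1)) ∩ {η | η 0 = ω 0} := by
  ext η
  simp only [pastEvt, shiftSeq, Set.mem_preimage, Set.mem_ofPred_eq, Set.mem_inter_iff]
  refine ⟨fun h => ⟨⟨fun i hi hi' => ?_, fun i hi hi' => ?_⟩, ?_⟩,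
    fun h => ⟨fun i hi hi' => ?_, fun i hi hi' => h.1.2 _ (by omega) (by omega)⟩⟩
  · have := h.1 (i - 1) (by omega) (by omega)
    rw [sub_add_cancel] at this
    rw [this]
    congr 1
    omega
  · have := h.2 (i - 1) (by omega) (by omega)
    rwa [sub_add_cancel] at this
  · exact h.1 (-1) (by omega) le_rfl
  · by_cases h1 : i = -1
    · subst h1
      exact h.2
    · rw [h.1.1 (i + 1) (by omega) (by omega)]
      congr 1
      omega

lemma pastEvt_eq_inter (n l : ℕ) (b : Bool) (ω : Past Bool) :
    pastEvt n (l + 1) b ω =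
      blockEvt (n + 1) l b ∩ {η | ∀ j < n, restrictPast η j = ω j} := by
  ext η
  simp only [pastEvt, blockEvt, restrictPast, Set.mem_ofPred_eq, Set.mem_inter_iff]
  refine ⟨fun h => ⟨fun i hi hi' => h.2 i (by omega) (by omega), fun j hj => ?_⟩,
    fun h => ⟨fun i hi hi' => ?_, fun i hi hi' => h.1 i (by omega) (by omega)⟩⟩
  · rw [h.1 _ (by omega) (by omega)]
    congr 1
  · rw [← h.2 _ (by omega)]
    congr 1
    omega

lemma measurable_restrictPast : Measurable (restrictPast : ZSeq Bool → Past Bool) :=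
  measurable_pi_iff.2 fun _ => measurable_pi_apply _

lemma measurableSet_agree (n : ℕ) (ω : Past Bool) :
    MeasurableSet {η : ZSeq Bool | ∀ j < n, restrictPast η j = ω j} := by
  have : {η : ZSeq Bool | ∀ j < n, restrictPast η j = ω j} =
      restrictPast ⁻¹' cyl (Finset.range n) ω := by
    ext η
    simp [cyl]
  rw [this]
  exact measurable_restrictPast (measurableSet_cyl _ _)

/-- A function depending on finitely many coordinates is a combination of cylinder indicators. -/
lemma DependsOn.eq_sum_agree {F : Past Bool → ℝ} {n : ℕ} (hF : DependsOn F (Set.Iio n)) :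
    F = ∑ τ : Fin n → Bool, F (fun j => if h : j < n then τ ⟨j, h⟩ else false) •
      agree n (fun j => if h : j < n then τ ⟨j, h⟩ else false) := by
  funext ω
  rw [Finset.sum_apply, Finset.sum_eq_single fun j : Fin n => ω j]
  · rw [Pi.smul_apply, agree, if_pos fun j hj => by rw [dif_pos hj], smul_eq_mul, mul_one]
    exact hF fun j hj => by rw [dif_pos (Set.mem_Iio.1 hj)]
  · intro τ _ hτ
    rw [Pi.smul_apply, agree, if_neg, smul_zero]
    intro h
    refine hτ (funext fun j => ?_)
    rw [h j j.2, dif_pos j.2]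
  · exact fun h => absurd (Finset.mem_univ _) h

lemma transfer_agree (P : Bool → Past Bool → ℝ) (n : ℕ) (ω ω' : Past Bool) :
    transfer P (agree (n + 1) ω) ω' = P (ω 0) ω' * agree n (fun j => ω (j + 1)) ω' := by
  have key : ∀ a, agree (n + 1) ω (consPast a ω') =
      if a = ω 0 then agree n (fun j => ω (j + 1)) ω' else 0 := by
    intro a
    have : (∀ j < n + 1, consPast a ω' j = ω j) ↔ a = ω 0 ∧ ∀ j < n, ω' j = ω (j + 1) := by
      refine ⟨fun h => ⟨h 0 n.succ_pos, fun j hj => h (j + 1) (Nat.succ_lt_succ hj)⟩,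
        fun h j hj => ?_⟩
      cases j with
      | zero => exact h.1
      | succ j => exact h.2 j (Nat.lt_of_succ_lt_succ hj)
    simp only [agree, this, ite_and]
  rw [transfer_apply]
  simp only [key, mul_ite, mul_zero]
  simp

/-- The event that the spins in `s` are all `b` in terms of the past of the shifted sequence. -/
lemma allEq_restrictPast_shift (b : Bool) {s : Finset ℤ} {M : ℕ} (hs : ∀ i ∈ s, i ≤ M)
    (η : ZSeq Bool) :
    allEq b (s.image fun i => ((M : ℤ) - i).toNat) (restrictPast (shiftSeq^[M + 1] η)) =
      (cyl s fun _ => b).indicator 1 η := by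
  have : (∀ j ∈ s.image fun i => ((M : ℤ) - i).toNat,
      restrictPast (shiftSeq^[M + 1] η) j = b) ↔ η ∈ cyl s fun _ => b := by
    simp only [Finset.forall_mem_image, mem_cyl, restrictPast, iterate_shiftSeq]
    refine forall₂_congr fun i hi => ?_
    have : -(((((M : ℤ) - i).toNat : ℕ) : ℤ) + 1) + ((M + 1 : ℕ) : ℤ) = i := by
      have := hs i hi
      omega
    rw [this]
  classical
  rw [allEq, Set.indicator_apply]
  exact if_congr this rfl rfl

lemma exists_nat_upper_bound (s : Finset ℤ) : ∃ M : ℕ, ∀ i ∈ s, i ≤ M :=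
  ⟨s.sup Int.toNat, fun i hi => by
    have : i.toNat ≤ s.sup Int.toNat := Finset.le_sup hi
    omega⟩

lemma real_cyl_const_eq_integral {μ : Measure (ZSeq Bool)} (b : Bool) {s : Finset ℤ} {M : ℕ}
    (hs : ∀ i ∈ s, i ≤ M) :
    μ.real (cyl s fun _ => b) =
      ∫ η, allEq b (s.image fun i => ((M : ℤ) - i).toNat) (restrictPast η)
        ∂(μ.map shiftSeq^[M + 1]) := by
  obtain ⟨m, hm⟩ := allEq_dependsOn b (s.image fun i => ((M : ℤ) - i).toNat)
  rw [integral_map (f := fun η => allEq b _ (restrictPast η))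
    (IsPlusPhase.measurable_shiftSeq.iterate _).aemeasurable
    (hm.continuous_of_Iio.comp continuous_restrictPast).measurable.aestronglyMeasurable]
  simp only [allEq_restrictPast_shift b hs]
  rw [integral_indicator_one (measurableSet_cyl s _)]

namespace IsAttractiveStationary

variable {ν : Measure (ZSeq Bool)} {b : Bool} {P : Bool → Past Bool → ℝ}

lemma measure_preimage_shiftSeq (hν : IsAttractiveStationary ν) {A : Set (ZSeq Bool)}
    (hA : MeasurableSet A) : ν (shiftSeq ⁻¹' A) = ν A := by
  conv_rhs => rw [← hν.shift]
  rw [Measure.map_apply IsPlusPhase.measurable_shiftSeq hA]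

lemma map_shiftSeq_cond (hν : IsAttractiveStationary ν) (n l : ℕ) (b : Bool) :
    (ν[|blockEvt n l b]).map shiftSeq = ν[|blockEvt (n + 1) l b] := by
  ext A hA
  have h1 := measurableSet_blockEvt (n + 1) l b
  rw [Measure.map_apply IsPlusPhase.measurable_shiftSeq hA,
    cond_apply (measurableSet_blockEvt n l b), cond_apply h1,
    ← preimage_shiftSeq_blockEvt n l b, ← Set.preimage_inter,
    hν.measure_preimage_shiftSeq h1, hν.measure_preimage_shiftSeq (h1.inter hA)]

lemma map_iterate_shiftSeq_cond (hν : IsAttractiveStationary ν) (n l k : ℕ) (b : Bool) :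
    (ν[|blockEvt n l b]).map shiftSeq^[k] = ν[|blockEvt (n + k) l b] := by
  induction k with
  | zero => simp
  | succ k ih =>
    rw [Function.iterate_succ', ← Measure.map_map IsPlusPhase.measurable_shiftSeq
      (IsPlusPhase.measurable_shiftSeq.iterate k), ih, hν.map_shiftSeq_cond, add_assoc]

lemma isProbabilityMeasure_cond (hν : IsAttractiveStationary ν) (n l : ℕ) (b : Bool) :
    IsProbabilityMeasure (ν[|blockEvt n l b]) :=
  have := hν.prob
  cond_isProbabilityMeasure fun h => (hν.blockEvt_pos n l b).ne' (by simp [measureReal_def, h])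

lemma tendsto_pastEvt_div (hν : IsAttractiveStationary ν) (hG : IsCondG ν b P) (n : ℕ)
    (ω : Past Bool) :
    Tendsto (fun l => ν.real (pastEvt n (l + 1) b ω) / ν.real (blockEvt (n + 1) l b)) atTop
      (𝓝 ((transfer P ^ n) (agree n ω) fun _ => b)) := by
  induction n generalizing ω with
  | zero =>
    refine (tendsto_congr fun l => ?_).2 tendsto_const_nhds
    rw [pastEvt_eq_inter]
    simp [agree, (hν.blockEvt_pos 1 l b).ne']
  | succ n ih =>
    set ω₁ : Past Bool := fun j => ω (j + 1)
    have h1 : (transfer P ^ (n + 1)) (agree (n + 1) ω) (fun _ => b) =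
        P (ω 0) (splice (fun _ => b) ω₁ n) * (transfer P ^ n) (agree n ω₁) fun _ => b := by
      rw [pow_succ, Module.End.mul_apply, transfer_iterate_congr P (b := b)
        (G := P (ω 0) (splice (fun _ => b) ω₁ n) • agree n ω₁) n 0 _ _ fun _ _ => rfl, map_smul]
      · rfl
      · intro ω' h'
        rw [transfer_agree, Pi.smul_apply, smul_eq_mul]
        unfold agree
        split_ifs with h
        · have : ω' = splice (fun _ => b) ω₁ n := by
            funext j
            unfold splice
            split_ifs with hj
            · exact h j hj
            · exact h' j (by omega)
          rw [← this]
        · simp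
    rw [h1]
    refine (tendsto_congr fun l => ?_).2
      (((tendsto_add_atTop_iff_nat 1).2 (hG.tendsto_condProbR (ω 0) ω₁ n).1).mul (ih ω₁))
    have h2 : ν.real (blockEvt (n + 1 + 1) l b) = ν.real (blockEvt (n + 1) l b) := by
      rw [measureReal_def, ← hν.measure_preimage_shiftSeq (measurableSet_blockEvt _ l b),
        preimage_shiftSeq_blockEvt, measureReal_def]
    have h3 : ν.real (pastEvt (n + 1) (l + 1) b ω) =
        ν.real (pastEvt n (l + 1) b ω₁ ∩ {η | η 0 = ω 0}) := by
      rw [measureReal_def, ← hν.measure_preimage_shiftSeq (measurableSet_pastEvt _ _ b ω),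
        preimage_shiftSeq_pastEvt, measureReal_def]
    have h4 := (hν.pastEvt_pos n (l + 1) b ω₁).ne'
    rw [h2, h3, condProbR_eq (measurableSet_pastEvt n (l + 1) b ω₁)]
    field_simp

lemma integral_agree (ω : Past Bool) (n l : ℕ) :
    ∫ η, agree n ω (restrictPast η) ∂ν[|blockEvt (n + 1) l b] =
      ν.real (pastEvt n (l + 1) b ω) / ν.real (blockEvt (n + 1) l b) := by
  have h1 : (fun η => agree n ω (restrictPast η)) =
      {η : ZSeq Bool | ∀ j < n, restrictPast η j = ω j}.indicator 1 := by
    funext η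
    simp [agree, Set.indicator_apply]
  rw [h1, integral_indicator_one (measurableSet_agree n ω), pastEvt_eq_inter,
    measureReal_def, cond_apply (measurableSet_blockEvt _ l b), ENNReal.toReal_mul,
    ENNReal.toReal_inv, div_eq_inv_mul]
  rfl

lemma tendsto_integral_of_dependsOn_Iio (hν : IsAttractiveStationary ν) (hG : IsCondG ν b P)
    {n : ℕ} {F : Past Bool → ℝ} (hF : DependsOn F (Set.Iio n)) :
    Tendsto (fun l => ∫ η, F (restrictPast η) ∂ν[|blockEvt (n + 1) l b]) atTop
      (𝓝 ((transfer P ^ n) F fun _ => b)) := by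
  rw [hF.eq_sum_agree, map_sum, Finset.sum_apply]
  simp only [map_smul, Pi.smul_apply, Finset.sum_apply, smul_eq_mul]
  refine (tendsto_congr fun l => ?_).2 (tendsto_finsetSum Finset.univ fun τ _ =>
    (hν.tendsto_pastEvt_div hG n _).const_mul _)
  rw [integral_finsetSum]
  · refine Finset.sum_congr rfl fun τ _ => ?_
    rw [integral_const_mul, integral_agree]
  · intro τ _
    have := hν.isProbabilityMeasure_cond (n + 1) l b
    refine Integrable.const_mul ?_ _
    have h1 : (fun η => agree n (fun j => if h : j < n then τ ⟨j, h⟩ else false)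
        (restrictPast η)) = {η : ZSeq Bool | ∀ j < n, restrictPast η j =
          if h : j < n then τ ⟨j, h⟩ else false}.indicator 1 := by
      funext η
      simp [agree, Set.indicator_apply]
    rw [h1]
    exact (integrable_const (1 : ℝ)).indicator (measurableSet_agree n _)

lemma tendsto_integral (hν : IsAttractiveStationary ν) (hG : IsCondG ν b P)
    {m : ℕ} {F : Past Bool → ℝ} (hF : DependsOn F (Set.Iio m)) (n : ℕ) :
    Tendsto (fun l => ∫ η, F (restrictPast η) ∂ν[|blockEvt (n + 1) l b]) atTop
      (𝓝 ((transfer P ^ n) F fun _ => b)) := by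
  have h1 := hν.tendsto_integral_of_dependsOn_Iio hG (dependsOn_splice F b n)
  rw [transfer_iterate_congr P (b := b) (G := fun ω => F (splice (fun _ => b) ω n)) n 0 _ _
    fun _ _ => rfl]
  · refine h1.congr' ?_
    filter_upwards [eventually_ge_atTop m] with l hl
    refine integral_congr_ae ?_
    filter_upwards [ae_cond_mem (measurableSet_blockEvt (n + 1) l b)] with η hη
    refine hF fun j hj => ?_
    unfold splice
    split_ifs with hjn
    · rfl
    · have := Set.mem_Iio.1 hj
      exact (hη _ (by omega) (by omega)).symm
  · intro ω hω
    congr 1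
    funext j
    unfold splice
    split_ifs with hjn
    · rfl
    · exact hω j (by omega)

end IsAttractiveStationary

namespace IsAttractiveStationary

variable {ν : Measure (ZSeq Bool)} {b : Bool} {P : Bool → Past Bool → ℝ}

lemma tendsto_cond_cyl_const (hν : IsAttractiveStationary ν) (hG : IsCondG ν b P)
    {s : Finset ℤ} {M : ℕ} (hs : ∀ i ∈ s, i ≤ M) (n : ℕ) :
    Tendsto (fun l => (ν[|blockEvt n l b]).real (cyl s fun _ => b)) atTop
      (𝓝 ((transfer P ^ (n + M)) (allEq b (s.image fun i => ((M : ℤ) - i).toNat))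
        fun _ => b)) := by
  obtain ⟨m, hm⟩ := allEq_dependsOn b (s.image fun i => ((M : ℤ) - i).toNat)
  simp only [real_cyl_const_eq_integral b hs, hν.map_iterate_shiftSeq_cond]
  exact hν.tendsto_integral hG hm (n + M)

/-- Existence of the iterated weak limit, its shift invariance, and the formula for the
expectations of local functions of the past. -/
lemma exists_condLimit (hν : IsAttractiveStationary ν) (hG : IsCondG ν b P) :
    ∃ ν' : Measure (ZSeq Bool), IsProbabilityMeasure ν' ∧ IsCondLimitMeasure ν b ν' ∧
      ν'.map shiftSeq = ν' ∧ ∀ (m : ℕ) (F : Past Bool → ℝ), DependsOn F (Set.Iio m) →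
        Tendsto (fun n => (transfer P ^ n) F fun _ => b) atTop
          (𝓝 (∫ η, F (restrictPast η) ∂ν')) := by
  have hP := hG.isAttractiveG hν
  let κ : ℕ → ℕ → ProbabilityMeasure (ZSeq Bool) := fun n l =>
    ⟨ν[|blockEvt n l b], hν.isProbabilityMeasure_cond n l b⟩
  have h1 : ∀ n, ∃ μ : ProbabilityMeasure (ZSeq Bool), Tendsto (κ n) atTop (𝓝 μ) := fun n =>
    exists_tendsto_of_cyl_const b (κ n) fun s =>
      let ⟨_, hM⟩ := exists_nat_upper_bound s
      ⟨_, hν.tendsto_cond_cyl_const hG hM n⟩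
  choose νs hνs using h1
  have h2 : ∀ (s : Finset ℤ) (M : ℕ), (∀ i ∈ s, i ≤ M) → ∀ n,
      (νs n : Measure (ZSeq Bool)).real (cyl s fun _ => b) =
        (transfer P ^ (n + M)) (allEq b (s.image fun i => ((M : ℤ) - i).toNat)) fun _ => b :=
    fun s M hM n => tendsto_nhds_unique ((ENNReal.tendsto_toReal (measure_ne_top _ _)).comp
      (tendsto_measure_cyl (hνs n) s fun _ => b)) (hν.tendsto_cond_cyl_const hG hM n)
  obtain ⟨ν', hν'⟩ : ∃ μ : ProbabilityMeasure (ZSeq Bool), Tendsto νs atTop (𝓝 μ) := by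
    refine exists_tendsto_of_cyl_const b νs fun s => ?_
    obtain ⟨M, hM⟩ := exists_nat_upper_bound s
    simp only [h2 s M hM]
    have h3 := tendsto_atTop_ciInf (hP.iterate_top_antitone (allEq_mono b
      (s.image fun i => ((M : ℤ) - i).toNat))) ⟨0, by
        rintro _ ⟨n, rfl⟩
        exact hP.iterate_nonneg (allEq_nonneg b _) n _⟩
    exact ⟨_, (tendsto_add_atTop_iff_nat M).2 h3⟩
  have hmap : ∀ n, (νs n).map IsPlusPhase.measurable_shiftSeq.aemeasurable = νs (n + 1) := by
    intro n
    have h3 := ProbabilityMeasure.tendsto_map_of_tendsto_of_continuous _ _ (hνs n)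
      continuous_shiftSeq
    refine tendsto_nhds_unique h3 ((tendsto_congr fun l => ?_).2 (hνs (n + 1)))
    exact Subtype.ext (hν.map_shiftSeq_cond n l b)
  refine ⟨ν', ν'.2, ⟨fun n => νs n, fun n s f => tendsto_measure_cyl (hνs n) s f,
    fun s f => tendsto_measure_cyl hν' s f⟩, ?_, fun m F hF => ?_⟩
  · have h3 := ProbabilityMeasure.tendsto_map_of_tendsto_of_continuous _ _ hν'
      continuous_shiftSeq
    have h4 := tendsto_nhds_unique h3 ((tendsto_congr hmap).2
      ((tendsto_add_atTop_iff_nat 1).2 hν'))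
    exact congrArg Subtype.val h4
  · have hc := hF.continuous_of_Iio.comp continuous_restrictPast
    refine ((tendsto_add_atTop_iff_nat 1).2 (tendsto_integral_of_continuous hν' hc)).congr
      fun n => ?_
    exact tendsto_nhds_unique (tendsto_integral_of_continuous (hνs (n + 1)) hc)
      (hν.tendsto_integral hG hF n)

end IsAttractiveStationary

lemma pastSigma_le : pastSigma Bool ≤ (inferInstance : MeasurableSpace (ZSeq Bool)) :=
  measurable_restrictPast.comap_le

lemma allEq_mul_eq_indicator (b : Bool) (t : Finset ℕ) (F : Past Bool → ℝ) (ω : Past Bool) :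
    F ω * allEq b t ω = (cyl t fun _ => b).indicator F ω := by
  classical
  rw [allEq, Set.indicator_apply, mul_ite, mul_one, mul_zero]
  exact if_congr Iff.rfl rfl rfl

lemma transfer_allEq (P : Bool → Past Bool → ℝ) (b : Bool) (t : Finset ℕ) :
    transfer P (allEq b (insert 0 (t.image (· + 1)))) = fun ω => P b ω * allEq b t ω := by
  have key : ∀ a ω, allEq b (insert 0 (t.image (· + 1))) (consPast a ω) =
      if a = b then allEq b t ω else 0 := by
    intro a ω
    simp only [allEq, Finset.forall_mem_insert, Finset.forall_mem_image, consPast, ite_and]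
  funext ω
  rw [transfer_apply]
  simp only [key, mul_ite, mul_zero]
  simp

lemma integral_restrictPast_shiftSeq {μ : Measure (ZSeq Bool)} (hμ : μ.map shiftSeq = μ)
    {F : Past Bool → ℝ} (hF : Measurable F) :
    ∫ η, F (consPast (η 0) (restrictPast η)) ∂μ = ∫ η, F (restrictPast η) ∂μ := by
  conv_rhs => rw [← hμ]
  rw [integral_map (f := fun η => F (restrictPast η))
    IsPlusPhase.measurable_shiftSeq.aemeasurable
    (hF.comp measurable_restrictPast).aestronglyMeasurable]
  simp only [restrictPast_shiftSeq]

lemma measurable_allEq (b : Bool) (t : Finset ℕ) : Measurable (allEq b t) :=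
  let ⟨_, hm⟩ := allEq_dependsOn b t
  hm.continuous_of_Iio.measurable

namespace IsAttractiveG

variable {b : Bool} {P : Bool → Past Bool → ℝ} {ν' : Measure (ZSeq Bool)}

lemma integrable_mul_allEq [IsFiniteMeasure ν'] (t : Finset ℕ)
    {Q : Past Bool → ℝ} (hQ : Measurable Q) (hQ0 : ∀ ω, |Q ω| ≤ 1) :
    Integrable (fun η => Q (restrictPast η) * allEq b t (restrictPast η)) ν' :=
  Integrable.of_bound
    ((hQ.comp measurable_restrictPast).mul
      ((measurable_allEq b t).comp measurable_restrictPast)).aestronglyMeasurable 1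
    (Eventually.of_forall fun η => by
      rw [Real.norm_eq_abs, abs_mul, abs_of_nonneg (allEq_nonneg b t _)]
      exact mul_le_one₀ (hQ0 _) (allEq_nonneg b t _) (allEq_le_one b t _))

/-- The limit of the iterates of the transfer operator at the maximal past is consistent
with `P` on the events that finitely many symbols are maximal. -/
lemma integral_mul_allEq (hP : IsAttractiveG b P) [IsProbabilityMeasure ν']
    (hshift : ν'.map shiftSeq = ν')
    (hlim : ∀ (m : ℕ) (F : Past Bool → ℝ), DependsOn F (Set.Iio m) →
      Tendsto (fun n => (transfer P ^ n) F fun _ => b) atTop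
        (𝓝 (∫ η, F (restrictPast η) ∂ν'))) (t : Finset ℕ) :
    ∫ η, P b (restrictPast η) * allEq b t (restrictPast η) ∂ν' =
      ∫ η, allEq b (insert 0 (t.image (· + 1))) (consPast (η 0) (restrictPast η)) ∂ν' := by
  rw [integral_restrictPast_shiftSeq hshift (measurable_allEq b _)]
  set c := ∫ η, allEq b (insert 0 (t.image (· + 1))) (restrictPast η) ∂ν'
  set H : Past Bool → ℝ := fun ω => P b ω * allEq b t ω
  let G : ℕ → Past Bool → ℝ := fun m ω => P b (splice (fun _ => b) ω m) * allEq b t ω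
  have habs : ∀ ω, |P b ω| ≤ 1 := fun ω => by
    rw [abs_of_nonneg (hP.nonneg b ω)]
    exact hP.le_one b ω
  have hHG : ∀ m, H ≤ G m := fun m ω =>
    mul_le_mul_of_nonneg_right (hP.splice_antitone ω m) (allEq_nonneg b t ω)
  have hc : Tendsto (fun n => (transfer P ^ n) H fun _ => b) atTop (𝓝 c) := by
    obtain ⟨m, hm⟩ := allEq_dependsOn b (insert 0 (t.image (· + 1)))
    have h1 := (tendsto_add_atTop_iff_nat 1).2 (hlim m _ hm)
    simpa only [pow_succ, Module.End.mul_apply, transfer_allEq] using h1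
  have hmeas : ∀ m, Measurable fun ω => P b (splice (fun _ => b) ω m) := fun m =>
    (dependsOn_splice (P b) b m).continuous_of_Iio.measurable
  have hGlim : ∀ m, Tendsto (fun n => (transfer P ^ n) (G m) fun _ => b) atTop
      (𝓝 (∫ η, G m (restrictPast η) ∂ν')) := by
    intro m
    obtain ⟨k, hk⟩ := allEq_dependsOn b t
    refine hlim (max m k) _ fun ω ω' h => ?_
    exact congrArg₂ (· * ·) ((dependsOn_splice (P b) b m).mono_Iio (le_max_left m k) h)
      (hk.mono_Iio (le_max_right m k) h)
  have hGmono : ∀ m, MonoFor b (G m) := fun m ω ω' h =>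
    mul_le_mul (hP.mono (splice_mono h m)) (allEq_mono b t h) (allEq_nonneg b t ω)
      (hP.nonneg b _)
  have hHle : ∀ m, ∫ η, H (restrictPast η) ∂ν' ≤ ∫ η, G m (restrictPast η) ∂ν' := fun m =>
    integral_mono (integrable_mul_allEq t (hP.measurable b) habs)
      (integrable_mul_allEq t (hmeas m) fun ω => habs _) fun η => hHG m _
  refine le_antisymm ?_ ?_
  · refine ge_of_tendsto' hc fun n => (hHle n).trans ?_
    have h1 : (transfer P ^ n) H (fun _ => b) = (transfer P ^ n) (G n) fun _ => b := by
      refine transfer_iterate_congr P n 0 (fun ω hω => ?_) _ fun _ _ => rfl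
      have : splice (fun _ => b) ω n = ω := by
        funext j
        unfold splice
        split_ifs with hj
        · rfl
        · exact (hω j (by omega)).symm
      simp only [H, G, this]
    rw [h1]
    exact (hP.iterate_top_antitone (hGmono n)).le_of_tendsto (hGlim n) n
  · have h1 : Tendsto (fun m => ∫ η, G m (restrictPast η) ∂ν') atTop
        (𝓝 (∫ η, H (restrictPast η) ∂ν')) := by
      refine tendsto_integral_of_dominated_convergence (fun _ => (1 : ℝ))
        (fun m => (integrable_mul_allEq t (hmeas m) fun ω => habs _).aestronglyMeasurable)
        (integrable_const _) (fun m => Eventually.of_forall fun η => ?_)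
        (Eventually.of_forall fun η => (hP.tendsto _).mul_const _)
      rw [Real.norm_eq_abs, abs_mul, abs_of_nonneg (allEq_nonneg b t _)]
      exact mul_le_one₀ (habs _) (allEq_nonneg b t _) (allEq_le_one b t _)
    refine ge_of_tendsto' h1 fun m => ?_
    exact le_of_tendsto_of_tendsto' hc (hGlim m) fun n => hP.iterate_mono (hHG m) n _

lemma setIntegral_eq (hP : IsAttractiveG b P) [IsProbabilityMeasure ν']
    (hshift : ν'.map shiftSeq = ν')
    (hlim : ∀ (m : ℕ) (F : Past Bool → ℝ), DependsOn F (Set.Iio m) →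
      Tendsto (fun n => (transfer P ^ n) F fun _ => b) atTop
        (𝓝 (∫ η, F (restrictPast η) ∂ν'))) {T : Set (Past Bool)} (hT : MeasurableSet T) :
    ∫ η in restrictPast ⁻¹' T, P b (restrictPast η) ∂ν' =
      ν'.real (restrictPast ⁻¹' T ∩ {η | η 0 = b}) := by
  have hint : Integrable (fun η => P b (restrictPast η)) ν' :=
    Integrable.of_bound ((hP.measurable b).comp measurable_restrictPast).aestronglyMeasurable 1
      (Eventually.of_forall fun η => by
        rw [Real.norm_eq_abs, abs_of_nonneg (hP.nonneg b _)]
        exact hP.le_one b _)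
  have hnn : ∀ μ : Measure (ZSeq Bool), 0 ≤ᵐ[μ] fun η => P b (restrictPast η) :=
    fun _ => Eventually.of_forall fun η => hP.nonneg b _
  let ρ₁ : Measure (Past Bool) :=
    (ν'.withDensity fun η => ENNReal.ofReal (P b (restrictPast η))).map restrictPast
  let ρ₂ : Measure (Past Bool) := (ν'.restrict {η | η 0 = b}).map restrictPast
  have hρ₁ : ∀ T : Set (Past Bool), MeasurableSet T → ρ₁ T =
      ENNReal.ofReal (∫ η in restrictPast ⁻¹' T, P b (restrictPast η) ∂ν') := by
    intro T hT
    rw [Measure.map_apply measurable_restrictPast hT,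
      withDensity_apply _ (measurable_restrictPast hT),
      ofReal_integral_eq_lintegral_ofReal hint.integrableOn (hnn _)]
  have hρ₂ : ∀ T : Set (Past Bool), MeasurableSet T → ρ₂ T =
      ENNReal.ofReal (ν'.real (restrictPast ⁻¹' T ∩ {η | η 0 = b})) := by
    intro T hT
    rw [Measure.map_apply measurable_restrictPast hT,
      Measure.restrict_apply (measurable_restrictPast hT), ofReal_measureReal]
  have hfin : IsFiniteMeasure ρ₁ :=
    ⟨by rw [hρ₁ _ MeasurableSet.univ]; exact ENNReal.ofReal_lt_top⟩
  have hρ : ρ₁ = ρ₂ := by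
    refine ext_of_cyl_const b fun t => ?_
    have ht := measurableSet_cyl t fun _ => b
    rw [hρ₁ _ ht, hρ₂ _ ht]
    congr 1
    have h1 := hP.integral_mul_allEq hshift hlim t
    simp only [allEq_mul_eq_indicator] at h1
    rw [← integral_indicator (measurable_restrictPast ht)]
    refine h1.trans ?_
    rw [← integral_indicator_one ((measurable_restrictPast ht).inter (measurableSet_coord 0 b))]
    congr 1
    funext η
    classical
    rw [allEq, Set.indicator_apply]
    refine if_congr ?_ rfl rfl
    simp only [Finset.forall_mem_insert, Finset.forall_mem_image, consPast]
    exact and_comm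
  have h2 := congrArg ENNReal.toReal (congrFun (congrArg DFunLike.coe hρ) T)
  rwa [hρ₁ T hT, hρ₂ T hT, ENNReal.toReal_ofReal measureReal_nonneg,
    ENNReal.toReal_ofReal (integral_nonneg_of_ae (hnn _))] at h2

lemma isGMeasure (hP : IsAttractiveG b P) [IsProbabilityMeasure ν']
    (hshift : ν'.map shiftSeq = ν')
    (hlim : ∀ (m : ℕ) (F : Past Bool → ℝ), DependsOn F (Set.Iio m) →
      Tendsto (fun n => (transfer P ^ n) F fun _ => b) atTop
        (𝓝 (∫ η, F (restrictPast η) ∂ν'))) : IsGMeasure ν' P := by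
  refine ⟨inferInstance, hshift, fun a => ?_⟩
  have hint : ∀ a, Integrable (fun η => P a (restrictPast η)) ν' := fun a =>
    Integrable.of_bound ((hP.measurable a).comp measurable_restrictPast).aestronglyMeasurable 1
      (Eventually.of_forall fun η => by
        rw [Real.norm_eq_abs, abs_of_nonneg (hP.nonneg a _)]
        exact hP.le_one a _)
  have key : ∀ a, ∀ T : Set (Past Bool), MeasurableSet T →
      ∫ η in restrictPast ⁻¹' T, P a (restrictPast η) ∂ν' =
        ν'.real (restrictPast ⁻¹' T ∩ {η | η 0 = a}) := by
    intro a T hT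
    by_cases hab : a = b
    · rw [hab]
      exact hP.setIntegral_eq hshift hlim hT
    · obtain rfl : a = !b := Bool.eq_not_of_ne hab
      have h1 := hP.setIntegral_eq hshift hlim hT
      have h2 : ν'.real (restrictPast ⁻¹' T ∩ {η | η 0 = b}) +
          ν'.real (restrictPast ⁻¹' T ∩ {η | η 0 = !b}) = ν'.real (restrictPast ⁻¹' T) := by
        rw [← measureReal_inter_add_sdiff (s := restrictPast ⁻¹' T) (measurableSet_coord 0 b)]
        congr 2
        ext η
        simp [Bool.eq_not]
      simp only [hP.not_eq]
      rw [integral_sub (integrable_const _) (hint b).integrableOn, h1]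
      simp only [integral_const, smul_eq_mul, mul_one, measureReal_restrict_apply_univ]
      linarith
  refine ae_eq_condExp_of_forall_setIntegral_eq pastSigma_le
    ((integrable_const (1 : ℝ)).indicator (measurableSet_coord 0 a))
    (fun s _ _ => (hint a).integrableOn) (fun s hs _ => ?_) ?_
  · obtain ⟨T, hT, rfl⟩ := hs
    rw [key a T hT, setIntegral_indicator (measurableSet_coord 0 a)]
    simp
  · exact ((hP.measurable a).comp (comap_measurable _)).aestronglyMeasurable

end IsAttractiveG

namespace IsGMeasure

variable {P : Bool → Past Bool → ℝ} {μ : Measure (ZSeq Bool)}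

lemma integral_indicator_mul (hμ : IsGMeasure μ P) (a : Bool) {g : Past Bool → ℝ}
    (hg : Measurable g) {C : ℝ} (hC : ∀ ω, |g ω| ≤ C) :
    ∫ η, g (restrictPast η) * {η : ZSeq Bool | η 0 = a}.indicator (fun _ => (1 : ℝ)) η ∂μ =
      ∫ η, P a (restrictPast η) * g (restrictPast η) ∂μ := by
  have := hμ.1
  have hind : Integrable ({η : ZSeq Bool | η 0 = a}.indicator fun _ => (1 : ℝ)) μ :=
    (integrable_const (1 : ℝ)).indicator (measurableSet_coord 0 a)
  have hgm : Measurable[pastSigma Bool] fun η : ZSeq Bool => g (restrictPast η) :=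
    hg.comp (comap_measurable _)
  have hgind := hind.bdd_mul (hg.comp measurable_restrictPast).aestronglyMeasurable
    (Eventually.of_forall fun η => hC (restrictPast η))
  rw [← integral_condExp pastSigma_le]
  refine integral_congr_ae ?_
  filter_upwards [condExp_mul_of_stronglyMeasurable_left hgm.stronglyMeasurable hgind hind,
    hμ.2.2 a] with η h1 h2
  refine h1.trans ?_
  rw [Pi.mul_apply, ← h2, mul_comm]

lemma integral_transfer (hμ : IsGMeasure μ P) {F : Past Bool → ℝ} (hF : Measurable F) {C : ℝ}
    (hC : ∀ ω, |F ω| ≤ C) (hP : ∀ a, Measurable (P a)) (hP1 : ∀ a ω, |P a ω| ≤ 1) :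
    ∫ η, transfer P F (restrictPast η) ∂μ = ∫ η, F (restrictPast η) ∂μ := by
  have := hμ.1
  have hcons : ∀ a, Measurable fun ω => F (consPast a ω) := fun a =>
    hF.comp (IsAttractiveG.measurable_consPast a)
  rw [← integral_restrictPast_shiftSeq hμ.2.1 hF]
  have h1 : (fun η : ZSeq Bool => F (consPast (η 0) (restrictPast η))) = fun η =>
      ∑ a, F (consPast a (restrictPast η)) *
        {η : ZSeq Bool | η 0 = a}.indicator (fun _ => (1 : ℝ)) η := by
    funext η
    rw [Finset.sum_eq_single (η 0)]
    · simp
    · intro a _ ha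
      rw [Set.indicator_of_notMem (fun h => ha h.symm), mul_zero]
    · exact fun h => absurd (Finset.mem_univ _) h
  simp only [transfer_apply]
  rw [h1, integral_finsetSum, integral_finsetSum]
  · refine Finset.sum_congr rfl fun a _ => ?_
    exact (hμ.integral_indicator_mul a (hcons a) fun ω => hC _).symm
  · intro a _
    exact ((integrable_const (1 : ℝ)).indicator (measurableSet_coord 0 a)).bdd_mul
      ((hcons a).comp measurable_restrictPast).aestronglyMeasurable
      (Eventually.of_forall fun η => hC (consPast a (restrictPast η)))
  · intro a _
    refine Integrable.of_bound (((hP a).mul (hcons a)).comp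
      measurable_restrictPast).aestronglyMeasurable C (Eventually.of_forall fun η => ?_)
    show ‖P a (restrictPast η) * F (consPast a (restrictPast η))‖ ≤ C
    rw [Real.norm_eq_abs, abs_mul, ← one_mul C]
    exact mul_le_mul (hP1 _ _) (hC _) (abs_nonneg _) zero_le_one

lemma integral_iterate {b : Bool} (hP : IsAttractiveG b P) (hμ : IsGMeasure μ P)
    {F : Past Bool → ℝ} (hF : Measurable F) {C : ℝ} (hC : ∀ ω, |F ω| ≤ C) (n : ℕ) :
    ∫ η, (transfer P ^ n) F (restrictPast η) ∂μ = ∫ η, F (restrictPast η) ∂μ := by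
  induction n with
  | zero => rfl
  | succ n ih =>
    rw [pow_succ', Module.End.mul_apply, hμ.integral_transfer (hP.measurable_iterate hF n)
      (hP.abs_iterate_le hC n) hP.measurable, ih]
    intro a ω
    rw [abs_of_nonneg (hP.nonneg a ω)]
    exact hP.le_one a ω

/-- Every consistent measure is dominated by the iterates at the maximal past. -/
lemma integral_allEq_le {b : Bool} (hP : IsAttractiveG b P) (hμ : IsGMeasure μ P)
    (t : Finset ℕ) (n : ℕ) :
    ∫ η, allEq b t (restrictPast η) ∂μ ≤ (transfer P ^ n) (allEq b t) fun _ => b := by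
  have := hμ.1
  have hC : ∀ ω, |allEq b t ω| ≤ 1 := fun ω => by
    rw [abs_of_nonneg (allEq_nonneg b t ω)]
    exact allEq_le_one b t ω
  have hF := measurable_allEq b t
  rw [← hμ.integral_iterate hP hF hC n]
  have h1 : Integrable (fun η => (transfer P ^ n) (allEq b t) (restrictPast η)) μ :=
    Integrable.of_bound ((hP.measurable_iterate hF n).comp
      measurable_restrictPast).aestronglyMeasurable 1
      (Eventually.of_forall fun η => hP.abs_iterate_le hC n _)
  refine (integral_mono h1 (integrable_const ((transfer P ^ n) (allEq b t) fun _ => b))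
    fun η => hP.iterate_monoFor (allEq_mono b t) n fun _ _ => rfl).trans ?_
  simp

end IsGMeasure

lemma map_iterate_shiftSeq {μ : Measure (ZSeq Bool)} (hμ : μ.map shiftSeq = μ) (k : ℕ) :
    μ.map shiftSeq^[k] = μ := by
  induction k with
  | zero => simp
  | succ k ih =>
    rw [Function.iterate_succ', ← Measure.map_map IsPlusPhase.measurable_shiftSeq
      (IsPlusPhase.measurable_shiftSeq.iterate k), ih, hμ]

namespace IsAttractiveG

variable {b : Bool} {P : Bool → Past Bool → ℝ} {ν' : Measure (ZSeq Bool)}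

lemma extremeGMeasure (hP : IsAttractiveG b P) (hν' : IsGMeasure ν' P)
    (hlim : ∀ (m : ℕ) (F : Past Bool → ℝ), DependsOn F (Set.Iio m) →
      Tendsto (fun n => (transfer P ^ n) F fun _ => b) atTop
        (𝓝 (∫ η, F (restrictPast η) ∂ν'))) : ExtremeGMeasure ν' P := by
  have hmax : ∀ μ, IsGMeasure μ P → ∀ s : Finset ℤ,
      μ.real (cyl s fun _ => b) ≤ ν'.real (cyl s fun _ => b) := by
    intro μ hμ s
    obtain ⟨M, hM⟩ := exists_nat_upper_bound s
    rw [real_cyl_const_eq_integral b hM, real_cyl_const_eq_integral b hM,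
      map_iterate_shiftSeq hμ.2.1, map_iterate_shiftSeq hν'.2.1]
    obtain ⟨m, hm⟩ := allEq_dependsOn b (s.image fun i => ((M : ℤ) - i).toNat)
    exact ge_of_tendsto' (hlim m _ hm) fun n => hμ.integral_allEq_le hP _ n
  refine ⟨hν', fun ν₁ ν₂ h₁ h₂ t ht heq => ?_⟩
  have hp := hν'.1
  have hp₁ := h₁.1
  have hp₂ := h₂.1
  have hsum : ∀ s : Finset ℤ, ν'.real (cyl s fun _ => b) =
      t * ν₁.real (cyl s fun _ => b) + (1 - t) * ν₂.real (cyl s fun _ => b) := by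
    intro s
    have hf₁ : IsFiniteMeasure (ENNReal.ofReal t • ν₁) :=
      Measure.smul_finite ν₁ ENNReal.ofReal_ne_top
    have hf₂ : IsFiniteMeasure (ENNReal.ofReal (1 - t) • ν₂) :=
      Measure.smul_finite ν₂ ENNReal.ofReal_ne_top
    conv_lhs => rw [heq]
    rw [measureReal_add_apply, measureReal_ennreal_smul_apply, measureReal_ennreal_smul_apply,
      ENNReal.toReal_ofReal ht.1.le, ENNReal.toReal_ofReal (sub_nonneg.2 ht.2.le)]
  have hle : ∀ s : Finset ℤ, ν₁.real (cyl s fun _ => b) = ν'.real (cyl s fun _ => b) ∧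
      ν₂.real (cyl s fun _ => b) = ν'.real (cyl s fun _ => b) := by
    intro s
    have e1 := hmax ν₁ h₁ s
    have e2 := hmax ν₂ h₂ s
    have e3 := hsum s
    have e4 := ht.1
    have e5 := sub_pos.2 ht.2
    constructor <;> refine le_antisymm (by assumption) ?_
    · nlinarith [mul_nonneg e5.le (sub_nonneg.2 e2)]
    · nlinarith [mul_nonneg e4.le (sub_nonneg.2 e1)]
  constructor <;> refine ext_of_cyl_const b fun s => ?_
  · exact (measureReal_eq_measureReal_iff).1 (hle s).1
  · exact (measureReal_eq_measureReal_iff).1 (hle s).2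

end IsAttractiveG

lemma IsAttractiveStationary.exists_extreme_condLimit {ν : Measure (ZSeq Bool)} {b : Bool}
    {P : Bool → Past Bool → ℝ} (hν : IsAttractiveStationary ν) (hG : IsCondG ν b P) :
    ∃ ν', IsCondLimitMeasure ν b ν' ∧ IsGMeasure ν' P ∧ ExtremeGMeasure ν' P := by
  obtain ⟨ν', hprob, hcond, hshift, hlim⟩ := hν.exists_condLimit hG
  have hP := hG.isAttractiveG hν
  have hg := hP.isGMeasure hshift hlim
  exact ⟨ν', hcond, hg, hP.extremeGMeasure hg hlim⟩

/-- For all `β > 0` and `h`, the iterated weak limits `ν_{β,h}^{+,±}` exist;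
`ν^{+,+}` (resp. `ν^{+,-}`) is a g-measure consistent with `P^{+,+}` (resp. `P^{+,-}`), and each
is an extreme point of the convex set of g-measures consistent with its g-function. -/
theorem condLimit_measures_exist_consistent_extremal
    (β h : ℝ) (hβ : 0 < β) (μp : Measure Cfg2) (hμp : IsPlusPhase β h μp)
    (Pp Pm : Bool → Past Bool → ℝ)
    (hPp : IsCondG (schonmann μp) true Pp) (hPm : IsCondG (schonmann μp) false Pm) :
    ∃ νp νm : Measure (ZSeq Bool),
      IsCondLimitMeasure (schonmann μp) true νp ∧
      IsCondLimitMeasure (schonmann μp) false νm ∧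
      IsGMeasure νp Pp ∧ IsGMeasure νm Pm ∧
      ExtremeGMeasure νp Pp ∧ ExtremeGMeasure νm Pm := by
  have hν := IsPlusPhase.schonmann_attractive hβ.le hμp
  obtain ⟨νp, h1, h2, h3⟩ := hν.exists_extreme_condLimit hPp
  obtain ⟨νm, h4, h5, h6⟩ := hν.exists_extreme_condLimit hPm
  exact ⟨νp, νm, h1, h4, h2, h5, h3, h6⟩
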